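/- There exists a constant C > 0 such that for every smooth w on ℝ₊×ℝ³, every dyadic τ ≥ 1, and every dyadic 1 ≤ U ≤ τ/4, ‖∂w‖_{L^∞_{t,x}(C^U_τ)} ≤ C ( U^{−1/2} τ^{−3/2} ‖∂ Z^{≤3} w‖_{L²L²(C̃^U_τ)} + U^{−1/2} τ^{−1/2} ‖□ Z^{≤2} w‖_{L²L²(C̃^U_τ)} ). -/

import Mathlib

open MeasureTheory Set Filter
open scoped RealInnerProductSpace

noncomputable section

/-- Euclidean `ℝ³`. -/
abbrev E3 : Type := EuclideanSpace ℝ (Fin 3)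

/-- time derivative `∂_t u`. -/
def dt (u : ℝ → E3 → ℝ) (t : ℝ) (x : E3) : ℝ := deriv (fun s => u s x) t

/-- spatial gradient `∇_x u`. -/
def grad (u : ℝ → E3 → ℝ) (t : ℝ) (x : E3) : E3 := gradient (u t) x

/-- radial derivative `∂_r u = (x/r)·∇_x u`. -/
def dr (u : ℝ → E3 → ℝ) (t : ℝ) (x : E3) : ℝ := ⟪(‖x‖⁻¹) • x, gradient (u t) x⟫

/-- angular gradient `∇̸u = ∇_x u − (x/r) ∂_r u`. -/
def angGrad (u : ℝ → E3 → ℝ) (t : ℝ) (x : E3) : E3 :=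
  gradient (u t) x - (‖x‖⁻¹ * dr u t x) • x

/-- coordinate partial derivative on `ℝ³`. -/
def pd (i : Fin 3) (f : E3 → ℝ) (x : E3) : ℝ := fderiv ℝ f x (EuclideanSpace.single i 1)

/-- spatial Laplacian. -/
def lap (f : E3 → ℝ) (x : E3) : ℝ := ∑ i : Fin 3, pd i (fun y => pd i f y) x

/-- d'Alembertian `□u = ∂_t²u − Δ_x u`. -/
def box (u : ℝ → E3 → ℝ) (t : ℝ) (x : E3) : ℝ := deriv (fun s => dt u s x) t - lap (u t) x

/-- `|∂u|²`, the squared length of the space-time gradient. -/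
def DuSq (u : ℝ → E3 → ℝ) (t : ℝ) (x : E3) : ℝ := (dt u t x)^2 + ‖grad u t x‖^2

/-- `L²L²` norm over a space-time region `Q`. -/
def L2st (f : ℝ → E3 → ℝ) (Q : Set (ℝ × E3)) : ℝ :=
  Real.sqrt (∫ q in Q, (f q.1 q.2)^2)

/-- `L²` norm in space. -/
def L2x (g : E3 → ℝ) : ℝ := Real.sqrt (∫ x : E3, (g x)^2)

/-- `L∞L²` norm over `ℝ₊×ℝ³`. -/
def LinfL2 (f : ℝ → E3 → ℝ) : ℝ := ⨆ t : Ici (0:ℝ), L2x (f t.1)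

/-- `L²L²` norm over `ℝ₊×ℝ³`. -/
def L2L2 (f : ℝ → E3 → ℝ) : ℝ := L2st f (Ici 0 ×ˢ univ)

/-- the dyadic strip `C_τ = {τ ≤ t ≤ 2τ, r ≤ t+2}`. -/
def Cstrip (τ : ℝ) : Set (ℝ × E3) := {q | τ ≤ q.1 ∧ q.1 ≤ 2*τ ∧ ‖q.2‖ ≤ q.1 + 2}

/-- the region `C^R_τ` (with the conventions for `R = 1` and `R = τ/2`). -/
def CRreg (τ R : ℝ) : Set (ℝ × E3) :=
  if R = 1 then Cstrip τ ∩ {q | ‖q.2‖ ≤ 2}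
  else if R = τ/2 then Cstrip τ ∩ {q | τ/2 ≤ q.1 - ‖q.2‖ ∧ τ/2 ≤ ‖q.2‖}
  else Cstrip τ ∩ {q | R ≤ ‖q.2‖ ∧ ‖q.2‖ ≤ 2*R}

/-- the region `C^U_τ` (with the convention for `U = 1`). -/
def CUreg (τ U : ℝ) : Set (ℝ × E3) :=
  if U = 1 then Cstrip τ ∩ {q | |q.1 - ‖q.2‖| ≤ 2}
  else Cstrip τ ∩ {q | U ≤ q.1 - ‖q.2‖ ∧ q.1 - ‖q.2‖ ≤ 2*U}

/-- the enlarged region `C̃^R_τ`. -/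
def CRtilde (τ R : ℝ) : Set (ℝ × E3) :=
  {q | 7/8*τ ≤ q.1 ∧ q.1 ≤ 17/8*τ ∧ ‖q.2‖ ≤ q.1 + 2} ∩
  (if R = 1 then {q | ‖q.2‖ ≤ 17/8} else {q | 7/8*R ≤ ‖q.2‖ ∧ ‖q.2‖ ≤ 17/8*R})

/-- the enlarged region `C̃^U_τ`. -/
def CUtilde (τ U : ℝ) : Set (ℝ × E3) :=
  {q | 7/8*τ ≤ q.1 ∧ q.1 ≤ 17/8*τ ∧ ‖q.2‖ ≤ q.1 + 2} ∩
  (if U = 1 then {q | |q.1 - ‖q.2‖| ≤ 17/8}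
   else {q | 7/8*U ≤ q.1 - ‖q.2‖ ∧ q.1 - ‖q.2‖ ≤ 17/8*U})

/-- `X_U = {U ≤ 1+|t−r| ≤ 2U}`. -/
def XUreg (U : ℝ) : Set (ℝ × E3) :=
  {q | U ≤ 1 + |q.1 - ‖q.2‖| ∧ 1 + |q.1 - ‖q.2‖| ≤ 2*U}

/-- the admissible vector fields `∂_t, ∂_{x_i}, Ω_{ij}, S` on `ℝ₊×ℝ³`. -/
def Zop : Fin 8 → (ℝ → E3 → ℝ) → (ℝ → E3 → ℝ) :=
  ![fun u t x => dt u t x,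
    fun u t x => pd 0 (u t) x,
    fun u t x => pd 1 (u t) x,
    fun u t x => pd 2 (u t) x,
    fun u t x => x 0 * pd 1 (u t) x - x 1 * pd 0 (u t) x,
    fun u t x => x 0 * pd 2 (u t) x - x 2 * pd 0 (u t) x,
    fun u t x => x 1 * pd 2 (u t) x - x 2 * pd 1 (u t) x,
    fun u t x => t * dt u t x + ⟪x, gradient (u t) x⟫]

/-- composition `Z^μ` of admissible vector fields. -/
def Ziter : List (Fin 8) → (ℝ → E3 → ℝ) → (ℝ → E3 → ℝ)
  | [] => fun u => u
  | i :: l => fun u => Zop i (Ziter l u)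

/-- `‖T Z^{≤N} w‖_{L²L²(Q)}`: the sum over all compositions `Z^μ` of at most `N`
admissible fields of the `L²L²(Q)` norms of `T (Z^μ w)`. -/
def ZnormT (T : (ℝ → E3 → ℝ) → (ℝ → E3 → ℝ)) (N : ℕ) (w : ℝ → E3 → ℝ)
    (Q : Set (ℝ × E3)) : ℝ :=
  ∑ n ∈ Finset.range (N+1), ∑ σ : Fin n → Fin 8, L2st (T (Ziter (List.ofFn σ) w)) Q

/-- `‖Z^{≤N} w‖_{L²L²(Q)}`. -/
def Znorm (N : ℕ) (w : ℝ → E3 → ℝ) (Q : Set (ℝ × E3)) : ℝ := ZnormT (fun v => v) N w Q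

/-- `‖∂_r Z^{≤N} w‖_{L²L²(Q)}`. -/
def ZnormDr (N : ℕ) (w : ℝ → E3 → ℝ) (Q : Set (ℝ × E3)) : ℝ :=
  ZnormT (fun v => fun t x => dr v t x) N w Q

/-- `‖∂ Z^{≤N} w‖_{L²L²(Q)}`. -/
def ZnormD (N : ℕ) (w : ℝ → E3 → ℝ) (Q : Set (ℝ × E3)) : ℝ :=
  ZnormT (fun v => fun t x => Real.sqrt (DuSq v t x)) N w Q

/-- `‖□ Z^{≤N} w‖_{L²L²(Q)}`. -/
def ZnormBox (N : ℕ) (w : ℝ → E3 → ℝ) (Q : Set (ℝ × E3)) : ℝ :=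
  ZnormT (fun v => fun t x => box v t x) N w Q

/-- The open half space `t > 0` of space-time. -/
def posTime : Set (ℝ × E3) := Ioi 0 ×ˢ univ

/-- Smoothness of a curried function on the open half space `t > 0`. -/
def SmoothPos (u : ℝ → E3 → ℝ) : Prop :=
  ContDiffOn ℝ (⊤ : ℕ∞) (fun q : ℝ × E3 => u q.1 q.2) posTime

lemma isOpen_posTime : IsOpen posTime := isOpen_Ioi.prod isOpen_univ

lemma mem_posTime {q : ℝ × E3} : q ∈ posTime ↔ 0 < q.1 := by simp [posTime]

lemma SmoothPos.contDiffAt {u : ℝ → E3 → ℝ} (hu : SmoothPos u) {q : ℝ × E3} (hq : 0 < q.1) :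
    ContDiffAt ℝ (⊤ : ℕ∞) (fun q : ℝ × E3 => u q.1 q.2) q :=
  ContDiffOn.contDiffAt hu (isOpen_posTime.mem_nhds (mem_posTime.2 hq))

lemma SmoothPos.differentiableAt {u : ℝ → E3 → ℝ} (hu : SmoothPos u) {q : ℝ × E3}
    (hq : 0 < q.1) : DifferentiableAt ℝ (fun q : ℝ × E3 => u q.1 q.2) q :=
  (hu.contDiffAt hq).differentiableAt (by simp)

/-- The constant coordinate vector fields `∂_t, ∂_1, ∂_2, ∂_3`. -/
def coordVec : Fin 4 → ℝ × E3 :=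
  ![(1, 0), (0, EuclideanSpace.single 0 1), (0, EuclideanSpace.single 1 1),
    (0, EuclideanSpace.single 2 1)]

/-- The constant part of the admissible vector fields. -/
def vecConst : Fin 8 → ℝ × E3 :=
  ![coordVec 0, coordVec 1, coordVec 2, coordVec 3, 0, 0, 0, 0]

/-- The generator of the rotation in the `(i, j)` plane. -/
def rotGen (i j : Fin 3) : (ℝ × E3) →L[ℝ] (ℝ × E3) :=
  ((EuclideanSpace.proj i : E3 →L[ℝ] ℝ).comp (ContinuousLinearMap.snd ℝ ℝ E3)).smulRight
      ((0 : ℝ), (EuclideanSpace.single j 1 : E3)) -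
    ((EuclideanSpace.proj j : E3 →L[ℝ] ℝ).comp (ContinuousLinearMap.snd ℝ ℝ E3)).smulRight
      ((0 : ℝ), (EuclideanSpace.single i 1 : E3))

/-- The linear part of the admissible vector fields. -/
def vecLin : Fin 8 → (ℝ × E3) →L[ℝ] (ℝ × E3) :=
  ![0, 0, 0, 0, rotGen 0 1, rotGen 0 2, rotGen 1 2, ContinuousLinearMap.id ℝ _]

/-- The admissible vector fields, as affine maps. -/
def vecField (a : Fin 8) (q : ℝ × E3) : ℝ × E3 := vecConst a + vecLin a q

lemma SmoothPos.dt_eq {u : ℝ → E3 → ℝ} (hu : SmoothPos u) {q : ℝ × E3} (hq : 0 < q.1) :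
    dt u q.1 q.2 = fderiv ℝ (fun p : ℝ × E3 => u p.1 p.2) q (1, 0) := by
  have h := (hu.differentiableAt hq).hasFDerivAt
  have h2 : HasDerivAt (fun s : ℝ => (s, q.2)) ((1 : ℝ), (0 : E3)) q.1 :=
    (hasDerivAt_id q.1).prodMk (hasDerivAt_const q.1 q.2)
  exact (h.comp_hasDerivAt q.1 h2).deriv

lemma SmoothPos.fderiv_eq {u : ℝ → E3 → ℝ} (hu : SmoothPos u) {q : ℝ × E3} (hq : 0 < q.1)
    (v : E3) :
    fderiv ℝ (u q.1) q.2 v = fderiv ℝ (fun p : ℝ × E3 => u p.1 p.2) q (0, v) := by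
  have h := (hu.differentiableAt hq).hasFDerivAt
  have h2 : HasFDerivAt (fun y : E3 => (q.1, y)) (ContinuousLinearMap.inr ℝ ℝ E3) q.2 :=
    (hasFDerivAt_prodMk_right q.1 q.2)
  have h3 := (HasFDerivAt.comp q.2 (g := fun p : ℝ × E3 => u p.1 p.2) h h2).fderiv
  have h4 : ((fun p : ℝ × E3 => u p.1 p.2) ∘ fun y : E3 => (q.1, y)) = u q.1 := rfl
  rw [h4] at h3
  rw [h3]; simp

lemma SmoothPos.Zop_eq {u : ℝ → E3 → ℝ} (hu : SmoothPos u) (a : Fin 8) {q : ℝ × E3}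
    (hq : 0 < q.1) :
    Zop a u q.1 q.2 = fderiv ℝ (fun p : ℝ × E3 => u p.1 p.2) q (vecField a q) := by
  have hsplit : ∀ (c : ℝ) (v : E3), (c, v) = c • ((1 : ℝ), (0 : E3)) + ((0 : ℝ), v) := by
    intro c v; ext <;> simp
  fin_cases a
  · simp [Zop, vecField, vecConst, vecLin, coordVec, hu.dt_eq hq]
  · simp [Zop, vecField, vecConst, vecLin, coordVec, pd, hu.fderiv_eq hq]
  · simp [Zop, vecField, vecConst, vecLin, coordVec, pd, hu.fderiv_eq hq]
  · simp [Zop, vecField, vecConst, vecLin, coordVec, pd, hu.fderiv_eq hq]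
  · simp [Zop, vecField, vecConst, vecLin, rotGen, pd, hu.fderiv_eq hq, -Prod.smul_mk, map_sub,
      map_smul]
  · simp [Zop, vecField, vecConst, vecLin, rotGen, pd, hu.fderiv_eq hq, -Prod.smul_mk, map_sub,
      map_smul]
  · simp [Zop, vecField, vecConst, vecLin, rotGen, pd, hu.fderiv_eq hq, -Prod.smul_mk, map_sub,
      map_smul]
  · simp [Zop, vecField, vecConst, vecLin]
    rw [hu.fderiv_eq hq, hu.dt_eq hq]
    conv_rhs => rw [← Prod.mk.eta (p := q), hsplit q.1 q.2, map_add, map_smul]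
    simp

lemma contDiff_vecField (a : Fin 8) : ContDiff ℝ (⊤ : ℕ∞) (vecField a) :=
  contDiff_const.add (vecLin a).contDiff

lemma SmoothPos.zop {u : ℝ → E3 → ℝ} (hu : SmoothPos u) (a : Fin 8) : SmoothPos (Zop a u) := by
  have h : ContDiffOn ℝ (⊤ : ℕ∞)
      (fun q => fderiv ℝ (fun p : ℝ × E3 => u p.1 p.2) q (vecField a q)) posTime :=
    (ContDiffOn.fderiv_of_isOpen hu isOpen_posTime (by simp)).clm_apply
      (contDiff_vecField a).contDiffOn
  exact h.congr fun q hq => hu.Zop_eq a (mem_posTime.1 hq)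

lemma SmoothPos.ziter {u : ℝ → E3 → ℝ} (hu : SmoothPos u) (l : List (Fin 8)) :
    SmoothPos (Ziter l u) := by
  induction l with
  | nil => exact hu
  | cons a l ih => exact ih.zop a

/-- The index of a coordinate derivative among the admissible fields. -/
def coordIdx (k : Fin 4) : Fin 8 := Fin.castLE (by norm_num) k

lemma vecField_coordIdx (k : Fin 4) (q : ℝ × E3) : vecField (coordIdx k) q = coordVec k := by
  fin_cases k <;> simp [vecField, vecConst, vecLin, coordIdx]

/-- Coordinates of a space-time vector in the frame `coordVec`. -/
def coordOf (v : ℝ × E3) : Fin 4 → ℝ := ![v.1, v.2 0, v.2 1, v.2 2]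

lemma sum_coordOf (v : ℝ × E3) : v = ∑ l, coordOf v l • coordVec l := by
  ext i
  · simp [Fin.sum_univ_four, coordOf, coordVec]
  · fin_cases i <;> simp [Fin.sum_univ_four, coordOf, coordVec]

/-- Structure constants of the commutators `[Z_a, ∂_k]`. -/
def commCoeff (a : Fin 8) (k l : Fin 4) : ℝ := -coordOf (vecLin a (coordVec k)) l

lemma SmoothPos.fderiv_Zop {u : ℝ → E3 → ℝ} (hu : SmoothPos u) (a : Fin 8) {q : ℝ × E3}
    (hq : 0 < q.1) (v : ℝ × E3) :
    fderiv ℝ (fun p : ℝ × E3 => Zop a u p.1 p.2) q v =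
      fderiv ℝ (fderiv ℝ (fun p : ℝ × E3 => u p.1 p.2)) q v (vecField a q) +
        fderiv ℝ (fun p : ℝ × E3 => u p.1 p.2) q (vecLin a v) := by
  have h1 : (fun p : ℝ × E3 => Zop a u p.1 p.2) =ᶠ[nhds q]
      fun p => fderiv ℝ (fun p : ℝ × E3 => u p.1 p.2) p (vecField a p) :=
    Filter.eventually_of_mem (isOpen_posTime.mem_nhds (mem_posTime.2 hq))
      fun p hp => hu.Zop_eq a (mem_posTime.1 hp)
  have h2 : HasFDerivAt (vecField a) (vecLin a) q :=
    (vecLin a).hasFDerivAt.const_add _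
  have h3 : DifferentiableAt ℝ (fderiv ℝ (fun p : ℝ × E3 => u p.1 p.2)) q :=
    ((hu.contDiffAt hq).fderiv_right (m := (⊤ : ℕ∞)) (by simp)).differentiableAt (by simp)
  rw [h1.fderiv_eq, (h3.hasFDerivAt.clm_apply h2).fderiv]
  simp [add_comm]

/-- The commutator of an admissible field with a coordinate derivative. -/
lemma SmoothPos.Zop_comm {u : ℝ → E3 → ℝ} (hu : SmoothPos u) (a : Fin 8) (k : Fin 4)
    {q : ℝ × E3} (hq : 0 < q.1) :
    Zop a (Zop (coordIdx k) u) q.1 q.2 =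
      Zop (coordIdx k) (Zop a u) q.1 q.2 +
        ∑ l, commCoeff a k l * Zop (coordIdx l) u q.1 q.2 := by
  have hs : IsSymmSndFDerivAt ℝ (fun p : ℝ × E3 => u p.1 p.2) q :=
    (hu.contDiffAt hq).isSymmSndFDerivAt (by simpa using ENat.LEInfty.out)
  have hl : vecLin (coordIdx k) = 0 := by fin_cases k <;> rfl
  rw [(hu.zop (coordIdx k)).Zop_eq a hq, (hu.zop a).Zop_eq (coordIdx k) hq, hu.fderiv_Zop _ hq,
    hu.fderiv_Zop _ hq, hs.eq (vecField a q), hl, vecField_coordIdx,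
    sum_coordOf (vecLin a (coordVec k))]
  simp [map_sum, hu.Zop_eq _ hq, vecField_coordIdx, commCoeff]

lemma SmoothPos.coord_comm {u : ℝ → E3 → ℝ} (hu : SmoothPos u) (k l : Fin 4)
    {q : ℝ × E3} (hq : 0 < q.1) :
    Zop (coordIdx k) (Zop (coordIdx l) u) q.1 q.2 =
      Zop (coordIdx l) (Zop (coordIdx k) u) q.1 q.2 := by
  have hl : vecLin (coordIdx k) = 0 := by fin_cases k <;> rfl
  rw [hu.Zop_comm _ _ hq]
  simp [commCoeff, hl, coordOf, Fin.sum_univ_four]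

lemma Ziter_append (l₁ l₂ : List (Fin 8)) (u : ℝ → E3 → ℝ) :
    Ziter (l₁ ++ l₂) u = Ziter l₁ (Ziter l₂ u) := by
  induction l₁ with
  | nil => rfl
  | cons a l ih => simp [Ziter, ih]

lemma Zop_lincomb {u v : ℝ → E3 → ℝ} {f : Fin 4 → ℝ → E3 → ℝ} (hu : SmoothPos u)
    (hv : SmoothPos v) (hf : ∀ l, SmoothPos (f l)) {c : Fin 4 → ℝ}
    (h : ∀ q : ℝ × E3, 0 < q.1 → u q.1 q.2 = v q.1 q.2 + ∑ l, c l * f l q.1 q.2)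
    (a : Fin 8) {q : ℝ × E3} (hq : 0 < q.1) :
    Zop a u q.1 q.2 = Zop a v q.1 q.2 + ∑ l, c l * Zop a (f l) q.1 q.2 := by
  have h1 : (fun p : ℝ × E3 => u p.1 p.2) =ᶠ[nhds q]
      fun p => v p.1 p.2 + ∑ l, c l * f l p.1 p.2 :=
    Filter.eventually_of_mem (isOpen_posTime.mem_nhds (mem_posTime.2 hq))
      fun p hp => h p (mem_posTime.1 hp)
  have h2 : HasFDerivAt (fun p : ℝ × E3 => v p.1 p.2 + ∑ l, c l * f l p.1 p.2)
      (fderiv ℝ (fun p : ℝ × E3 => v p.1 p.2) q +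
        ∑ l, c l • fderiv ℝ (fun p : ℝ × E3 => f l p.1 p.2) q) q :=
    (hv.differentiableAt hq).hasFDerivAt.add
      (HasFDerivAt.fun_sum fun l _ => ((hf l).differentiableAt hq).hasFDerivAt.const_mul (c l))
  rw [hu.Zop_eq a hq, h1.fderiv_eq, h2.fderiv, hv.Zop_eq a hq]
  simp [(hf _).Zop_eq a hq]

lemma Ziter_lincomb {u v : ℝ → E3 → ℝ} {f : Fin 4 → ℝ → E3 → ℝ} (hu : SmoothPos u)
    (hv : SmoothPos v) (hf : ∀ l, SmoothPos (f l)) {c : Fin 4 → ℝ}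
    (h : ∀ q : ℝ × E3, 0 < q.1 → u q.1 q.2 = v q.1 q.2 + ∑ l, c l * f l q.1 q.2)
    (μ : List (Fin 8)) : ∀ q : ℝ × E3, 0 < q.1 →
    Ziter μ u q.1 q.2 = Ziter μ v q.1 q.2 + ∑ l, c l * Ziter μ (f l) q.1 q.2 := by
  induction μ with
  | nil => exact h
  | cons a μ ih =>
    exact fun q hq => Zop_lincomb (hu.ziter μ) (hv.ziter μ) (fun l => (hf l).ziter μ) ih a hq

/-- The total size of the structure constants. -/
def commBound : ℝ := ∑ a, ∑ k, ∑ l, |commCoeff a k l|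

lemma commBound_nonneg : 0 ≤ commBound := by unfold commBound; positivity

lemma sum_commCoeff_le (a : Fin 8) (k : Fin 4) : ∑ l, |commCoeff a k l| ≤ commBound :=
  (Finset.single_le_sum (f := fun k => ∑ l, |commCoeff a k l|)
      (fun _ _ => by positivity) (Finset.mem_univ k)).trans
    (Finset.single_le_sum (f := fun a => ∑ k, ∑ l, |commCoeff a k l|)
      (fun _ _ => by positivity) (Finset.mem_univ a))

/-- Moving a coordinate derivative to the left of a string of admissible fields. -/
lemma Ziter_coord_bound (κ μ : List (Fin 8)) {q : ℝ × E3} (hq : 0 < q.1) {B : ℝ} :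
    ∀ {u : ℝ → E3 → ℝ} (_ : SmoothPos u) (k : Fin 4),
      (∀ (l : Fin 4) (ν : List (Fin 8)), ν.length ≤ μ.length →
        |Ziter κ (Zop (coordIdx l) (Ziter ν u)) q.1 q.2| ≤ B) →
      |Ziter κ (Ziter μ (Zop (coordIdx k) u)) q.1 q.2| ≤ (1 + commBound) ^ μ.length * B := by
  induction μ using List.reverseRecOn with
  | nil => intro u hu k h; simpa [Ziter] using h k [] le_rfl
  | append_singleton μ b ih =>
    intro u hu k h
    have hK := commBound_nonneg
    have hu' : ∀ l, SmoothPos (Zop (coordIdx l) u) := fun l => hu.zop _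
    have key := Ziter_lincomb (u := Zop b (Zop (coordIdx k) u)) (v := Zop (coordIdx k) (Zop b u))
      (f := fun l => Zop (coordIdx l) u) (c := commCoeff b k) ((hu' k).zop b)
      ((hu.zop b).zop _) hu' (fun q hq => hu.Zop_comm b k hq) (κ ++ μ) q hq
    simp only [Ziter_append] at key
    have e : Ziter (μ ++ [b]) (Zop (coordIdx k) u) = Ziter μ (Zop b (Zop (coordIdx k) u)) := by
      rw [Ziter_append]; rfl
    rw [e, key]
    have h1 := ih (hu.zop b) k fun l ν hν => by
      have := h l (ν ++ [b]) (by simpa using hν)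
      rwa [Ziter_append] at this
    have h2 : ∀ l, |Ziter κ (Ziter μ (Zop (coordIdx l) u)) q.1 q.2| ≤
        (1 + commBound) ^ μ.length * B :=
      fun l => ih hu l fun l ν hν => h l ν (hν.trans (by simp))
    set X := (1 + commBound) ^ μ.length * B
    have hX : 0 ≤ X := (abs_nonneg _).trans h1
    calc _ ≤ X + ∑ l, |commCoeff b k l| * X := by
          refine (abs_add_le _ _).trans (add_le_add h1 ((Finset.abs_sum_le_sum_abs _ _).trans
            (Finset.sum_le_sum fun l _ => ?_)))
          rw [abs_mul]
          exact mul_le_mul_of_nonneg_left (h2 l) (abs_nonneg _)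
      _ ≤ X + commBound * X := by
          rw [← Finset.sum_mul]
          gcongr
          exact sum_commCoeff_le b k
      _ = _ := by simp [X]; ring

lemma radial_transfer {t r x y z Q M : ℝ} (ht : 0 < t) (hr : 0 < r) (hx : |x| ≤ r)
    (htr : t ≤ 16 * r) (hd : |t - r| ≤ 16 * r) (h : |r ^ 2 * y + t * x * z| ≤ 3 * r * Q)
    (hM : |t - r| * |z| ≤ M) : |t - r| * |y| ≤ 16 * M + 48 * Q := by
  have hQ : 0 ≤ Q := by
    have := (abs_nonneg _).trans h
    by_contra hQ
    nlinarith [mul_pos hr (neg_pos.2 (not_le.1 hQ))]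
  have hM0 : 0 ≤ M := le_trans (by positivity) hM
  have h1 : r ^ 2 * |y| ≤ t * r * |z| + 3 * r * Q := by
    have h2 : r ^ 2 * y = (r ^ 2 * y + t * x * z) - t * x * z := by ring
    calc r ^ 2 * |y| = |r ^ 2 * y| := by rw [abs_mul, abs_of_pos (by positivity : 0 < r ^ 2)]
      _ ≤ 3 * r * Q + |t * x * z| := by
          rw [h2]; exact (abs_sub _ _).trans (add_le_add_left h _)
      _ ≤ _ := by
          rw [abs_mul, abs_mul, abs_of_pos ht]
          nlinarith [mul_le_mul_of_nonneg_right (mul_le_mul_of_nonneg_left hx ht.le) (abs_nonneg z)]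
  have h3 : r ^ 2 * (|t - r| * |y|) ≤ r ^ 2 * (16 * M + 48 * Q) := by
    calc r ^ 2 * (|t - r| * |y|) = |t - r| * (r ^ 2 * |y|) := by ring
      _ ≤ |t - r| * (t * r * |z| + 3 * r * Q) := mul_le_mul_of_nonneg_left h1 (abs_nonneg _)
      _ = t * r * (|t - r| * |z|) + |t - r| * (3 * r * Q) := by ring
      _ ≤ (16 * r) * r * M + 16 * r * (3 * r * Q) := by gcongr
      _ = _ := by ring
  exact le_of_mul_le_mul_left h3 (by positivity)

lemma abs_three_le {x y z r A B C Q : ℝ} (hx : |x| ≤ r) (hy : |y| ≤ r) (hz : |z| ≤ r)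
    (hA : |A| ≤ Q) (hB : |B| ≤ Q) (hC : |C| ≤ Q) : |x * A + y * B + z * C| ≤ 3 * r * Q := by
  have hr := (abs_nonneg _).trans hx
  have h : ∀ {x A : ℝ}, |x| ≤ r → |A| ≤ Q → |x * A| ≤ r * Q := fun hx hA => by
    rw [abs_mul]; exact mul_le_mul hx hA (abs_nonneg _) hr
  have := h hx hA
  have := h hy hB
  have := h hz hC
  have := abs_add_three (x * A) (y * B) (z * C)
  linarith

/-- If `S` and the rotations applied to a space-time gradient are bounded by `Q`, and the
d'Alembertian by `b`, then `|t - r|` times the Hessian is bounded by a multiple of `Q + τ b`. -/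
lemma hessian_bound {t r τ Q b : ℝ} {x : Fin 3 → ℝ} {a : Fin 4 → Fin 4 → ℝ}
    (hr : 0 < r) (ht : 0 < t) (hxr : x 0 ^ 2 + x 1 ^ 2 + x 2 ^ 2 = r ^ 2)
    (hr1 : r ≤ 4 * τ) (htr : t ≤ 16 * r)
    (hsymm : ∀ α, a α 0 = a 0 α)
    (h01 : ∀ β, |x 0 * a 2 β - x 1 * a 1 β| ≤ Q) (h02 : ∀ β, |x 0 * a 3 β - x 2 * a 1 β| ≤ Q)
    (h12 : ∀ β, |x 1 * a 3 β - x 2 * a 2 β| ≤ Q)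
    (hS : ∀ β, |t * a 0 β + (x 0 * a 1 β + x 1 * a 2 β + x 2 * a 3 β)| ≤ Q)
    (hbox : |a 0 0 - (a 1 1 + a 2 2 + a 3 3)| ≤ b) (α β : Fin 4) :
    |t - r| * |a α β| ≤ 4000 * (Q + τ * b) := by
  have hx0 : |x 0| ≤ r := abs_le_of_sq_le_sq (by nlinarith [sq_nonneg (x 1), sq_nonneg (x 2)]) hr.le
  have hx1 : |x 1| ≤ r := abs_le_of_sq_le_sq (by nlinarith [sq_nonneg (x 0), sq_nonneg (x 2)]) hr.le
  have hx2 : |x 2| ≤ r := abs_le_of_sq_le_sq (by nlinarith [sq_nonneg (x 1), sq_nonneg (x 0)]) hr.le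
  have hd : |t - r| ≤ 16 * r := by rw [abs_le]; constructor <;> linarith
  have hQ : 0 ≤ Q := (abs_nonneg _).trans (h01 0)
  have hb : 0 ≤ b := (abs_nonneg _).trans hbox
  have hτ : 0 < τ := by linarith
  have e1 : ∀ β, |r ^ 2 * a 1 β + t * x 0 * a 0 β| ≤ 3 * r * Q := fun β => by
    have := abs_three_le hx0 ((abs_neg _).trans_le hx1) ((abs_neg _).trans_le hx2)
      (hS β) (h01 β) (h02 β)
    convert this using 2
    rw [← hxr]; ring
  have e2 : ∀ β, |r ^ 2 * a 2 β + t * x 1 * a 0 β| ≤ 3 * r * Q := fun β => by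
    have := abs_three_le hx1 hx0 ((abs_neg _).trans_le hx2)
      (hS β) (h01 β) (h12 β)
    convert this using 2
    rw [← hxr]; ring
  have e3 : ∀ β, |r ^ 2 * a 3 β + t * x 2 * a 0 β| ≤ 3 * r * Q := fun β => by
    have := abs_three_le hx2 hx0 hx1 (hS β) (h02 β) (h12 β)
    convert this using 2
    rw [← hxr]; ring
  have h00 : |t - r| * |a 0 0| ≤ 4 * τ * b + 10 * Q := by
    have hid : (t + r) * ((t - r) * a 0 0) = -(r ^ 2 * (a 0 0 - (a 1 1 + a 2 2 + a 3 3)))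
        + t * (t * a 0 0 + (x 0 * a 1 0 + x 1 * a 2 0 + x 2 * a 3 0))
        - (r ^ 2 * a 1 1 + t * x 0 * a 0 1) - (r ^ 2 * a 2 2 + t * x 1 * a 0 2)
        - (r ^ 2 * a 3 3 + t * x 2 * a 0 3) := by
      rw [hsymm 1, hsymm 2, hsymm 3]; ring
    have hle : |(t + r) * ((t - r) * a 0 0)| ≤ r ^ 2 * b + t * Q + 9 * r * Q := by
      have p1 : |r ^ 2 * (a 0 0 - (a 1 1 + a 2 2 + a 3 3))| ≤ r ^ 2 * b := by
        rw [abs_mul, abs_of_pos (by positivity : 0 < r ^ 2)]; gcongr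
      have p2 : |t * (t * a 0 0 + (x 0 * a 1 0 + x 1 * a 2 0 + x 2 * a 3 0))| ≤ t * Q := by
        rw [abs_mul, abs_of_pos ht]; gcongr; exact hS 0
      rw [hid, abs_le]
      have q1 := abs_le.1 p1
      have q2 := abs_le.1 p2
      have q3 := abs_le.1 (e1 1)
      have q4 := abs_le.1 (e2 2)
      have q5 := abs_le.1 (e3 3)
      constructor <;> linarith [q1.1, q1.2, q2.1, q2.2, q3.1, q3.2, q4.1, q4.2, q5.1, q5.2]
    rw [abs_mul, abs_of_pos (by positivity : 0 < t + r), abs_mul] at hle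
    refine le_of_mul_le_mul_left (hle.trans ?_) (by positivity : 0 < t + r)
    have m1 : r ^ 2 * b ≤ (t + r) * (4 * τ * b) := by
      calc r ^ 2 * b = r * (r * b) := by ring
        _ ≤ (t + r) * (4 * τ * b) := by gcongr; linarith
    nlinarith [mul_nonneg ht.le hQ, mul_nonneg hr.le hQ]
  have hτb := mul_nonneg hτ.le hb
  have hj0 : ∀ α, |t - r| * |a α 0| ≤ 16 * (4 * τ * b + 10 * Q) + 48 * Q := by
    have g1 := radial_transfer ht hr hx0 htr hd (e1 0) h00
    have g2 := radial_transfer ht hr hx1 htr hd (e2 0) h00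
    have g3 := radial_transfer ht hr hx2 htr hd (e3 0) h00
    intro α
    fin_cases α
    · exact h00.trans (by linarith)
    · exact g1
    · exact g2
    · exact g3
  have h0j : ∀ α, |t - r| * |a 0 α| ≤ 16 * (4 * τ * b + 10 * Q) + 48 * Q := fun α =>
    hsymm α ▸ hj0 α
  have g1 := radial_transfer ht hr hx0 htr hd (e1 β) (h0j β)
  have g2 := radial_transfer ht hr hx1 htr hd (e2 β) (h0j β)
  have g3 := radial_transfer ht hr hx2 htr hd (e3 β) (h0j β)
  fin_cases α
  · exact (h0j β).trans (by linarith)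
  · exact g1.trans (by linarith)
  · exact g2.trans (by linarith)
  · exact g3.trans (by linarith)

lemma inner_gradient_eq_sum (f : E3 → ℝ) (x : E3) :
    ⟪x, gradient f x⟫ = x 0 * pd 0 f x + x 1 * pd 1 f x + x 2 * pd 2 f x := by
  have hx : x = x 0 • EuclideanSpace.single 0 1 + x 1 • EuclideanSpace.single 1 1 +
      x 2 • (EuclideanSpace.single 2 1 : E3) := by
    ext i; fin_cases i <;> simp
  rw [real_inner_comm, ← InnerProductSpace.toDual_apply_apply (𝕜 := ℝ), toDual_gradient]
  have key : ∀ L : E3 →L[ℝ] ℝ, L x = x 0 * L (EuclideanSpace.single 0 1) +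
      x 1 * L (EuclideanSpace.single 1 1) + x 2 * L (EuclideanSpace.single 2 1) := fun L => by
    conv_lhs => rw [hx]
    simp
  exact key _

lemma DuSq_eq_sum (u : ℝ → E3 → ℝ) (t : ℝ) (x : E3) :
    DuSq u t x = ∑ k, (Zop (coordIdx k) u t x) ^ 2 := by
  have h : ∀ i, (grad u t x) i = pd i (u t) x := fun i => by
    have := EuclideanSpace.inner_single_right i (1 : ℝ) (gradient (u t) x)
    rw [← InnerProductSpace.toDual_apply_apply (𝕜 := ℝ), toDual_gradient] at this
    simpa [grad, pd] using this.symm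
  rw [DuSq, EuclideanSpace.real_norm_sq_eq, Fin.sum_univ_three, Fin.sum_univ_four, h, h, h]
  simp only [coordIdx, Zop]
  rw [add_assoc, add_assoc, add_assoc]
  rfl

lemma SmoothPos.hessian_bound {v : ℝ → E3 → ℝ} (hv : SmoothPos v) {q : ℝ × E3} {τ Q b : ℝ}
    (hq : 0 < q.1) (hr : 0 < ‖q.2‖) (hr1 : ‖q.2‖ ≤ 4 * τ) (htr : q.1 ≤ 16 * ‖q.2‖)
    (hQ : ∀ (a : Fin 8) (β : Fin 4), |Zop a (Zop (coordIdx β) v) q.1 q.2| ≤ Q)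
    (hb : |box v q.1 q.2| ≤ b) (α β : Fin 4) :
    |q.1 - ‖q.2‖| * |Zop (coordIdx α) (Zop (coordIdx β) v) q.1 q.2| ≤ 4000 * (Q + τ * b) := by
  refine _root_.hessian_bound (x := fun i => q.2 i)
    (a := fun α β => Zop (coordIdx α) (Zop (coordIdx β) v) q.1 q.2) hr hq ?_ hr1 htr
    (fun α => hv.coord_comm α 0 hq) (fun β => hQ 4 β) (fun β => hQ 5 β) (fun β => hQ 6 β)
    (fun β => ?_) ?_ α β
  · rw [EuclideanSpace.real_norm_sq_eq, Fin.sum_univ_three]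
  · have := hQ 7 β
    change |q.1 * dt _ q.1 q.2 + ⟪q.2, gradient _ q.2⟫| ≤ Q at this
    rw [inner_gradient_eq_sum] at this
    exact this
  · have : box v q.1 q.2 = _ - _ := rfl
    rw [this, lap, Fin.sum_univ_three] at hb
    exact hb

/-- The pointwise sum of a functional over all strings of at most `N` admissible fields. -/
def wordSum (T : (ℝ → E3 → ℝ) → (ℝ → E3 → ℝ)) (N : ℕ) (w : ℝ → E3 → ℝ) (q : ℝ × E3) : ℝ :=
  ∑ n ∈ Finset.range (N + 1), ∑ σ : Fin n → Fin 8, |T (Ziter (List.ofFn σ) w) q.1 q.2|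

lemma wordSum_nonneg (T : (ℝ → E3 → ℝ) → (ℝ → E3 → ℝ)) (N : ℕ) (w : ℝ → E3 → ℝ) (q : ℝ × E3) :
    0 ≤ wordSum T N w q := by unfold wordSum; positivity

lemma le_wordSum (T : (ℝ → E3 → ℝ) → (ℝ → E3 → ℝ)) {N : ℕ} (w : ℝ → E3 → ℝ) (q : ℝ × E3)
    {ν : List (Fin 8)} (hν : ν.length ≤ N) : |T (Ziter ν w) q.1 q.2| ≤ wordSum T N w q := by
  have h1 := Finset.single_le_sum
    (f := fun σ : Fin ν.length → Fin 8 => |T (Ziter (List.ofFn σ) w) q.1 q.2|)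
    (fun _ _ => abs_nonneg _) (Finset.mem_univ ν.get)
  have h2 := Finset.single_le_sum (s := Finset.range (N + 1))
    (f := fun n => ∑ σ : Fin n → Fin 8, |T (Ziter (List.ofFn σ) w) q.1 q.2|)
    (fun _ _ => by positivity) (Finset.mem_range.2 (Nat.lt_succ_of_le hν))
  simp only [List.ofFn_get] at h1
  exact h1.trans h2

/-- The pointwise size of `∂ Z^{≤3} w`. -/
def gradWords (w : ℝ → E3 → ℝ) : ℝ × E3 → ℝ :=
  wordSum (fun v => fun t x => Real.sqrt (DuSq v t x)) 3 w

/-- The pointwise size of `□ Z^{≤2} w`. -/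
def boxWords (w : ℝ → E3 → ℝ) : ℝ × E3 → ℝ := wordSum (fun v => fun t x => box v t x) 2 w

lemma coord_le_gradWords (w : ℝ → E3 → ℝ) (q : ℝ × E3) (l : Fin 4)
    {ν : List (Fin 8)} (hν : ν.length ≤ 3) :
    |Zop (coordIdx l) (Ziter ν w) q.1 q.2| ≤ gradWords w q := by
  refine le_trans ?_ (le_wordSum (fun v => fun t x => Real.sqrt (DuSq v t x)) w q hν)
  rw [abs_of_nonneg (Real.sqrt_nonneg _), DuSq_eq_sum]
  exact Real.abs_le_sqrt (Finset.single_le_sum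
    (f := fun k => (Zop (coordIdx k) (Ziter ν w) q.1 q.2) ^ 2)
    (fun _ _ => sq_nonneg _) (Finset.mem_univ l))

/-- The constant in the pointwise bounds. -/
def wordConst : ℝ := 8000 * (1 + commBound) ^ 5

lemma SmoothPos.coord_words_bound {w : ℝ → E3 → ℝ} (hw : SmoothPos w) {q : ℝ × E3}
    (hq : 0 < q.1) {μ : List (Fin 8)} (hμ : μ.length ≤ 2) (k : Fin 4) :
    |Ziter μ (Zop (coordIdx k) w) q.1 q.2| ≤ wordConst * gradWords w q := by
  have hP : 0 ≤ gradWords w q := wordSum_nonneg _ _ _ _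
  have h1 : 1 ≤ 1 + commBound := by linarith [commBound_nonneg]
  refine (Ziter_coord_bound [] μ hq hw k (B := gradWords w q) fun l ν hν =>
    coord_le_gradWords w q l (by lia)).trans ?_
  gcongr
  calc (1 + commBound) ^ μ.length ≤ (1 + commBound) ^ 5 := pow_le_pow_right₀ h1 (by lia)
    _ ≤ wordConst := by unfold wordConst; nlinarith [one_le_pow₀ h1 (n := 5)]

lemma SmoothPos.hessian_words_bound {w : ℝ → E3 → ℝ} (hw : SmoothPos w) {q : ℝ × E3} {τ U : ℝ}
    (hq : 0 < q.1) (hr : 0 < ‖q.2‖) (hr1 : ‖q.2‖ ≤ 4 * τ) (htr : q.1 ≤ 16 * ‖q.2‖)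
    (hU0 : 0 < U) (hU : U = 1 ∨ U ≤ 2 * |q.1 - ‖q.2‖|)
    {μ : List (Fin 8)} (hμ : μ.length ≤ 2) (j k : Fin 4) :
    U * |Ziter μ (Zop (coordIdx j) (Zop (coordIdx k) w)) q.1 q.2| ≤
      wordConst * (gradWords w q + τ * boxWords w q) := by
  set P := gradWords w q
  set b := boxWords w q
  have hP : 0 ≤ P := wordSum_nonneg _ _ _ _
  have hb : 0 ≤ b := wordSum_nonneg _ _ _ _
  have hτ : 0 < τ := by linarith
  have h1 : 1 ≤ 1 + commBound := by linarith [commBound_nonneg]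
  set K := 1 + commBound
  have hE : ∀ (l m : Fin 4) (ν : List (Fin 8)), ν.length ≤ 2 →
      |Zop (coordIdx l) (Zop (coordIdx m) (Ziter ν w)) q.1 q.2| ≤ 8000 * K * (P + τ * b) / U := by
    intro l m ν hν
    rw [le_div_iff₀ hU0]
    rcases hU with hU | hU
    · have h2 := coord_le_gradWords w q l (ν := coordIdx m :: ν) (by simp; lia)
      have h3 : Ziter (coordIdx m :: ν) w = Zop (coordIdx m) (Ziter ν w) := rfl
      rw [h3] at h2
      rw [hU, mul_one]
      nlinarith [mul_nonneg hτ.le hb, mul_nonneg (sub_nonneg.2 h1) hP,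
        mul_nonneg (sub_nonneg.2 h1) (mul_nonneg hτ.le hb)]
    · have h2 := (hw.ziter ν).hessian_bound (Q := K * P) hq hr hr1 htr (fun a β => by
        have := Ziter_coord_bound [] [a] hq (hw.ziter ν) β (B := P) fun l ν' hν' => by
          have := coord_le_gradWords w q l (ν := ν' ++ ν) (by simp at hν' ⊢; lia)
          rwa [Ziter_append] at this
        simpa [Ziter] using this) (le_wordSum (fun v => fun t x => box v t x) w q hν) l m
      set X := |Zop (coordIdx l) (Zop (coordIdx m) (Ziter ν w)) q.1 q.2|
      have hX : 0 ≤ X := abs_nonneg _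
      change _ ≤ 4000 * (K * P + τ * b) at h2
      nlinarith [mul_le_mul_of_nonneg_right hU hX,
        mul_nonneg (sub_nonneg.2 h1) (mul_nonneg hτ.le hb)]
  set E := 8000 * K * (P + τ * b) / U
  have hE0 : 0 ≤ E := (abs_nonneg _).trans (hE 0 0 [] (by simp))
  have h2 : ∀ (l : Fin 4) (ν : List (Fin 8)), ν.length ≤ μ.length →
      |Ziter [] (Zop (coordIdx l) (Ziter ν (Zop (coordIdx k) w))) q.1 q.2| ≤ K ^ 2 * E := by
    intro l ν hν
    have := Ziter_coord_bound [coordIdx l] ν hq hw k (B := E) fun m ν' hν' =>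
      hE l m ν' (by lia)
    exact this.trans (by gcongr; exact hν.trans hμ)
  have h3 := Ziter_coord_bound [] μ hq (hw.zop (coordIdx k)) j h2
  have h4 : |Ziter μ (Zop (coordIdx j) (Zop (coordIdx k) w)) q.1 q.2| ≤ K ^ 2 * (K ^ 2 * E) :=
    h3.trans (by gcongr)
  calc _ ≤ U * (K ^ 2 * (K ^ 2 * E)) := by gcongr
    _ = wordConst * (P + τ * b) := by
        have : U * E = 8000 * K * (P + τ * b) := by simp only [E]; field_simp
        unfold wordConst
        calc U * (K ^ 2 * (K ^ 2 * E)) = K ^ 4 * (U * E) := by ring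
          _ = _ := by rw [this]; ring

lemma sq_intervalIntegral_le {f : ℝ → ℝ} {a b : ℝ} (hab : a ≤ b)
    (hf : ContinuousOn f (Icc a b)) : (∫ t in a..b, f t) ^ 2 ≤ (b - a) * ∫ t in a..b, f t ^ 2 := by
  rcases hab.eq_or_lt with rfl | hlt
  · simp
  have hu : uIcc a b = Icc a b := uIcc_of_le hab
  set I := ∫ t in a..b, f t
  have i1 : IntervalIntegrable f volume a b := (hu ▸ hf).intervalIntegrable
  have i2 : IntervalIntegrable (fun t => f t ^ 2) volume a b :=
    ((hu ▸ hf).pow 2).intervalIntegrable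
  have h0 : 0 ≤ ∫ t in a..b, ((b - a) * f t - I) ^ 2 :=
    intervalIntegral.integral_nonneg hab fun t _ => sq_nonneg _
  have h1 : ∫ t in a..b, ((b - a) * f t - I) ^ 2 =
      (b - a) ^ 2 * (∫ t in a..b, f t ^ 2) - 2 * (b - a) * I * I + (b - a) * I ^ 2 := by
    have : ∀ t, ((b - a) * f t - I) ^ 2 =
        ((b - a) ^ 2 * f t ^ 2 - 2 * (b - a) * I * f t) + I ^ 2 := fun t => by ring
    simp_rw [this]
    rw [intervalIntegral.integral_add ((i2.const_mul _).sub (i1.const_mul _))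
      intervalIntegrable_const, intervalIntegral.integral_sub (i2.const_mul _) (i1.const_mul _),
      intervalIntegral.integral_const_mul, intervalIntegral.integral_const_mul,
      intervalIntegral.integral_const, smul_eq_mul]
  have h2 : 0 < b - a := sub_pos.2 hlt
  have h3 : 0 ≤ (b - a) * ((b - a) * (∫ t in a..b, f t ^ 2) - I ^ 2) := by
    rw [h1] at h0; linarith
  linarith [nonneg_of_mul_nonneg_right h3 h2]

lemma ofReal_intervalIntegral {f : ℝ → ℝ} {a b : ℝ} (hab : a ≤ b)
    (hf : ContinuousOn f (Icc a b)) (h0 : ∀ t ∈ Icc a b, 0 ≤ f t) :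
    ENNReal.ofReal (∫ t in a..b, f t) = ∫⁻ t in Icc a b, ENNReal.ofReal (f t) := by
  rw [intervalIntegral.integral_of_le hab, ← integral_Icc_eq_integral_Ioc,
    ofReal_integral_eq_lintegral_ofReal (hf.integrableOn_Icc)
      ((ae_restrict_iff' measurableSet_Icc).2 (Eventually.of_forall h0))]

/-- One-dimensional Sobolev inequality at the left endpoint of an interval. -/
lemma sq_left_le {h h' : ℝ → ℝ} {a b : ℝ} (hab : a < b)
    (hd : ∀ t ∈ Icc a b, HasDerivAt h (h' t) t) (hc : ContinuousOn h' (Icc a b)) :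
    ENNReal.ofReal (h a ^ 2) ≤
      ∫⁻ t in Icc a b, ENNReal.ofReal (2 / (b - a) * h t ^ 2 + 2 * (b - a) * h' t ^ 2) := by
  have hL : 0 < b - a := sub_pos.2 hab
  have hu : uIcc a b = Icc a b := uIcc_of_le hab.le
  have hch : ContinuousOn h (Icc a b) := fun t ht => (hd t ht).continuousAt.continuousWithinAt
  have hk : ContinuousOn (fun t => -h t + (b - t) * h' t) (Icc a b) := by fun_prop
  have e1 : ∫ t in a..b, (-h t + (b - t) * h' t) = -((b - a) * h a) := by
    rw [intervalIntegral.integral_eq_sub_of_hasDerivAt (f := fun t => (b - t) * h t)]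
    · ring
    · intro t ht
      exact (((hasDerivAt_id' t).const_sub b).fun_mul (hd t (hu ▸ ht))).congr_deriv (by ring)
    · exact (hu ▸ hk).intervalIntegrable
  have e2 := sq_intervalIntegral_le hab.le hk
  have hm : ContinuousOn (fun t => 2 / (b - a) * h t ^ 2 + 2 * (b - a) * h' t ^ 2) (Icc a b) := by
    fun_prop
  have e3 : ∫ t in a..b, (-h t + (b - t) * h' t) ^ 2 ≤
      ∫ t in a..b, (b - a) * (2 / (b - a) * h t ^ 2 + 2 * (b - a) * h' t ^ 2) := by
    refine intervalIntegral.integral_mono_on hab.le (hu ▸ (hk.pow 2)).intervalIntegrable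
      (hu ▸ (continuousOn_const.mul hm)).intervalIntegrable fun t ht => ?_
    have : (b - a) * (2 / (b - a) * h t ^ 2 + 2 * (b - a) * h' t ^ 2) =
        2 * h t ^ 2 + 2 * ((b - a) * h' t) ^ 2 := by field_simp
    rw [this]
    have h1 : ((b - t) * h' t) ^ 2 ≤ ((b - a) * h' t) ^ 2 := by
      rw [mul_pow, mul_pow]
      gcongr
      · linarith [ht.2]
      · exact ht.1
    nlinarith [sq_nonneg (h t + (b - t) * h' t)]
  rw [intervalIntegral.integral_const_mul] at e3
  rw [← ofReal_intervalIntegral hab.le hm fun t _ => by positivity]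
  refine ENNReal.ofReal_le_ofReal (le_of_mul_le_mul_left ?_ (by positivity : 0 < (b - a) ^ 2))
  calc (b - a) ^ 2 * h a ^ 2 = (∫ t in a..b, (-h t + (b - t) * h' t)) ^ 2 := by rw [e1]; ring
    _ ≤ (b - a) * ((b - a) * ∫ t in a..b, (2 / (b - a) * h t ^ 2 + 2 * (b - a) * h' t ^ 2)) :=
        e2.trans (mul_le_mul_of_nonneg_left e3 hL.le)
    _ = _ := by ring

/-- Weighted second-order Taylor estimate on the unit interval. -/
lemma sq_zero_le {g g₁ g₂ : ℝ → ℝ} (h1 : ∀ s ∈ Icc (0 : ℝ) 1, HasDerivAt g (g₁ s) s)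
    (h2 : ∀ s ∈ Icc (0 : ℝ) 1, HasDerivAt g₁ (g₂ s) s) (hc : ContinuousOn g₂ (Icc 0 1))
    {B : ℝ → ℝ} (hB : ∀ s ∈ Icc (0 : ℝ) 1, 2 * |g s| + 4 * |g₁ s| + |g₂ s| ≤ B s) :
    ENNReal.ofReal (g 0 ^ 2) ≤
      4 * ∫⁻ σ in Icc (0 : ℝ) 1, ENNReal.ofReal (σ ^ 6) * ENNReal.ofReal (B (σ ^ 2) ^ 2) := by
  have hmaps : MapsTo (fun σ : ℝ => σ ^ 2) (Icc 0 1) (Icc 0 1) := fun σ hσ =>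
    ⟨sq_nonneg _, pow_le_one₀ hσ.1 hσ.2⟩
  have hcg : ContinuousOn g (Icc 0 1) := fun t ht => (h1 t ht).continuousAt.continuousWithinAt
  have hcg₁ : ContinuousOn g₁ (Icc 0 1) := fun t ht => (h2 t ht).continuousAt.continuousWithinAt
  have hsq : ContinuousOn (fun σ : ℝ => σ ^ 2) (Icc 0 1) := by fun_prop
  have hu : uIcc (0 : ℝ) 1 = Icc 0 1 := uIcc_of_le zero_le_one
  set k : ℝ → ℝ := fun s => (1 - s) ^ 2 * g₂ s - 4 * (1 - s) * g₁ s + 2 * g s with hk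
  have hck : ContinuousOn k (Icc 0 1) := by fun_prop
  have hf : ContinuousOn (fun σ => 2 * σ ^ 3 * k (σ ^ 2)) (Icc 0 1) :=
    (by fun_prop : ContinuousOn (fun σ : ℝ => 2 * σ ^ 3) (Icc 0 1)).mul (hck.comp hsq hmaps)
  have e1 : ∫ σ in (0 : ℝ)..1, 2 * σ ^ 3 * k (σ ^ 2) = g 0 := by
    rw [intervalIntegral.integral_eq_sub_of_hasDerivAt (f := fun σ =>
      (fun s => s * ((1 - s) ^ 2 * g₁ s - 2 * (1 - s) * g s) - (1 - s) ^ 2 * g s) (σ ^ 2))]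
    · simp
    · intro σ hσ
      rw [hu] at hσ
      have d1 := h1 _ (hmaps hσ)
      have d2 := h2 _ (hmaps hσ)
      have d0 := (hasDerivAt_id' (σ ^ 2)).const_sub 1
      have d3 := ((hasDerivAt_id' (σ ^ 2)).fun_mul (((d0.fun_pow 2).fun_mul d2).fun_sub
        ((d0.const_mul 2).fun_mul d1))).fun_sub ((d0.fun_pow 2).fun_mul d1)
      have d4 := HasDerivAt.comp (h := fun σ : ℝ => σ ^ 2) σ d3 (hasDerivAt_pow 2 σ)
      exact d4.congr_deriv (by simp [hk]; ring)
    · exact (hu ▸ hf).intervalIntegrable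
  have e2 := sq_intervalIntegral_le zero_le_one hf
  rw [e1, sub_zero, one_mul] at e2
  refine (ENNReal.ofReal_le_ofReal e2).trans ?_
  rw [ofReal_intervalIntegral zero_le_one (hf.fun_pow 2) fun _ _ => sq_nonneg _,
    ← lintegral_const_mul' _ _ (by simp)]
  refine setLIntegral_mono' measurableSet_Icc fun σ hσ => ?_
  have hkB : |k (σ ^ 2)| ≤ B (σ ^ 2) := by
    refine le_trans ?_ (hB _ (hmaps hσ))
    obtain ⟨hs0, hs1⟩ : σ ^ 2 ∈ Icc (0 : ℝ) 1 := hmaps hσ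
    simp only [hk]
    generalize σ ^ 2 = s at hs0 hs1
    have a1 : |(1 - s) ^ 2 * g₂ s| ≤ |g₂ s| := by
      rw [abs_mul]
      refine mul_le_of_le_one_left (abs_nonneg _) ?_
      rw [abs_of_nonneg (sq_nonneg _)]
      exact pow_le_one₀ (by linarith) (by linarith)
    have a2 : |4 * (1 - s) * g₁ s| ≤ 4 * |g₁ s| := by
      rw [abs_mul]
      refine mul_le_mul_of_nonneg_right ?_ (abs_nonneg _)
      rw [abs_of_nonneg (by linarith)]; linarith
    have a3 : |2 * g s| = 2 * |g s| := by rw [abs_mul]; simp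
    have := abs_add_le ((1 - s) ^ 2 * g₂ s - 4 * (1 - s) * g₁ s) (2 * g s)
    have := abs_sub ((1 - s) ^ 2 * g₂ s) (4 * (1 - s) * g₁ s)
    linarith
  have h4 : (4 : ENNReal) = ENNReal.ofReal 4 := by simp
  rw [h4, ← ENNReal.ofReal_mul (by positivity), ← ENNReal.ofReal_mul (by positivity)]
  refine ENNReal.ofReal_le_ofReal ?_
  have := sq_le_sq' (by linarith [neg_abs_le (k (σ ^ 2))]) ((le_abs_self _).trans hkB)
  calc (2 * σ ^ 3 * k (σ ^ 2)) ^ 2 = 4 * (σ ^ 6 * k (σ ^ 2) ^ 2) := by ring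
    _ ≤ _ := by gcongr

/-- The indices of the rotations and of the scaling field. -/
def homIdx (a : Fin 4) : Fin 8 := Fin.natAdd 4 a

/-- Components `x_i v_j - x_j v_i` and `x · v` of `v` with respect to the point `x`. -/
def pathNum (v x : E3) : Fin 4 → ℝ :=
  ![x 0 * v 1 - x 1 * v 0, x 0 * v 2 - x 2 * v 0, x 1 * v 2 - x 2 * v 1, ⟪x, v⟫]

/-- Derivative of `pathNum v` in the direction `v`. -/
def pathNumDeriv (v : E3) : Fin 4 → ℝ := ![0, 0, 0, ‖v‖ ^ 2]

/-- The conical lift of a spatial point: the point over `x` on the cone `t = κ|x|`. -/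
def coneLift (κ : ℝ) (x : E3) : ℝ × E3 := (κ * ‖x‖, x)

lemma hasDerivAt_line (x v : E3) (s : ℝ) : HasDerivAt (fun s : ℝ => x + s • v) v s := by
  simpa using ((hasDerivAt_id s).smul_const v).const_add x

lemma hasDerivAt_normSq_line (x v : E3) (s : ℝ) :
    HasDerivAt (fun s : ℝ => ‖x + s • v‖ ^ 2) (2 * ⟪x + s • v, v⟫) s :=
  (hasDerivAt_line x v s).norm_sq

lemma hasDerivAt_pathNum (x v : E3) (a : Fin 4) (s : ℝ) :
    HasDerivAt (fun s : ℝ => pathNum v (x + s • v) a) (pathNumDeriv v a) s := by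
  fin_cases a
  · change HasDerivAt (fun s : ℝ => (x + s • v) 0 * v 1 - (x + s • v) 1 * v 0) 0 s
    have e : (fun s : ℝ => (x + s • v) 0 * v 1 - (x + s • v) 1 * v 0) =
        fun _ => x 0 * v 1 - x 1 * v 0 := by
      funext s; simp; ring
    rw [e]; exact hasDerivAt_const _ _
  · change HasDerivAt (fun s : ℝ => (x + s • v) 0 * v 2 - (x + s • v) 2 * v 0) 0 s
    have e : (fun s : ℝ => (x + s • v) 0 * v 2 - (x + s • v) 2 * v 0) =
        fun _ => x 0 * v 2 - x 2 * v 0 := by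
      funext s; simp; ring
    rw [e]; exact hasDerivAt_const _ _
  · change HasDerivAt (fun s : ℝ => (x + s • v) 1 * v 2 - (x + s • v) 2 * v 1) 0 s
    have e : (fun s : ℝ => (x + s • v) 1 * v 2 - (x + s • v) 2 * v 1) =
        fun _ => x 1 * v 2 - x 2 * v 1 := by
      funext s; simp; ring
    rw [e]; exact hasDerivAt_const _ _
  · change HasDerivAt (fun s : ℝ => ⟪x + s • v, v⟫) (‖v‖ ^ 2) s
    have e : (fun s : ℝ => ⟪x + s • v, v⟫) = fun s => ⟪x, v⟫ + s * ‖v‖ ^ 2 := by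
      funext s; rw [inner_add_left, real_inner_smul_left, real_inner_self_eq_norm_sq]
    rw [e]
    exact (((hasDerivAt_id' s).mul_const _).const_add _).congr_deriv (by ring)

lemma inner_eq_sum_three (x v : E3) : ⟪x, v⟫ = x 0 * v 0 + x 1 * v 1 + x 2 * v 2 := by
  rw [PiLp.inner_apply, Fin.sum_univ_three]
  simp [mul_comm]

lemma normSq_eq_sum_three (x : E3) : ‖x‖ ^ 2 = x 0 ^ 2 + x 1 ^ 2 + x 2 ^ 2 := by
  rw [EuclideanSpace.real_norm_sq_eq, Fin.sum_univ_three]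

lemma hasDerivAt_coneLift (κ : ℝ) (x v : E3) (s : ℝ) (hx : 0 < ‖x + s • v‖) :
    HasDerivAt (fun s : ℝ => coneLift κ (x + s • v))
      (∑ a, (pathNum v (x + s • v) a / ‖x + s • v‖ ^ 2) •
        vecField (homIdx a) (coneLift κ (x + s • v))) s := by
  have h1 : HasDerivAt (fun s : ℝ => ‖x + s • v‖) (⟪x + s • v, v⟫ / ‖x + s • v‖) s := by
    have := (hasDerivAt_normSq_line x v s).sqrt (by positivity)
    simp only [Real.sqrt_sq (norm_nonneg _)] at this
    exact this.congr_deriv (by field_simp)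
  refine ((h1.const_mul κ).prodMk (hasDerivAt_line x v s)).congr_deriv ?_
  generalize x + s • v = y at hx ⊢
  have hy := normSq_eq_sum_three y
  have hy0 : y 0 ^ 2 + y 1 ^ 2 + y 2 ^ 2 ≠ 0 := by rw [← hy]; positivity
  ext i
  · simp [Fin.sum_univ_four, homIdx, pathNum, vecField, vecConst, vecLin, coneLift, rotGen]
    field_simp
  · fin_cases i <;>
    · simp [Fin.sum_univ_four, homIdx, pathNum, vecField, vecConst, vecLin, coneLift, rotGen,
        hy, inner_eq_sum_three]
      field_simp
      ring

/-- Chain rule along a segment lifted to a cone. -/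
lemma SmoothPos.hasDerivAt_coneLift {F : ℝ → E3 → ℝ} (hF : SmoothPos F) {κ : ℝ} (hκ : 0 < κ)
    (x v : E3) (s : ℝ) (hx : 0 < ‖x + s • v‖) :
    HasDerivAt (fun s : ℝ => F (coneLift κ (x + s • v)).1 (coneLift κ (x + s • v)).2)
      (∑ a, pathNum v (x + s • v) a / ‖x + s • v‖ ^ 2 *
        Zop (homIdx a) F (coneLift κ (x + s • v)).1 (coneLift κ (x + s • v)).2) s := by
  have hq : 0 < (coneLift κ (x + s • v)).1 := mul_pos hκ hx
  have h := (hF.differentiableAt hq).hasFDerivAt.comp_hasDerivAt s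
    (_root_.hasDerivAt_coneLift κ x v s hx)
  refine h.congr_deriv ?_
  simp [hF.Zop_eq _ hq]

lemma abs_pathNum_le (v x : E3) (hv : 7 * ‖v‖ ≤ ‖x‖) (a : Fin 4) :
    7 * |pathNum v x a| ≤ 2 * ‖x‖ ^ 2 := by
  have hx : ∀ i, |x i| ≤ ‖x‖ := fun i => by simpa using PiLp.norm_apply_le x i
  have hv' : ∀ i, |v i| ≤ ‖v‖ := fun i => by simpa using PiLp.norm_apply_le v i
  have hp : ∀ i j, |x i * v j| ≤ ‖x‖ * ‖v‖ := fun i j => by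
    rw [abs_mul]; exact mul_le_mul (hx i) (hv' j) (abs_nonneg _) (norm_nonneg _)
  have hs : ∀ i j, 7 * |x i * v j - x j * v i| ≤ 2 * ‖x‖ ^ 2 := fun i j => by
    have := abs_sub (x i * v j) (x j * v i)
    nlinarith [hp i j, hp j i, norm_nonneg x]
  fin_cases a
  · exact hs 0 1
  · exact hs 0 2
  · exact hs 1 2
  · have := abs_real_inner_le_norm x v
    simp only [pathNum]
    change 7 * |⟪x, v⟫| ≤ _
    nlinarith [norm_nonneg x, norm_nonneg v]

/-- Derivative of the coefficients of the path. -/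
def pathCoeffDeriv (v x : E3) (a : Fin 4) : ℝ :=
  (pathNumDeriv v a * ‖x‖ ^ 2 - pathNum v x a * (2 * ⟪x, v⟫)) / (‖x‖ ^ 2) ^ 2

lemma abs_pathCoeff_le {v x : E3} (hx : 0 < ‖x‖) (hv : 7 * ‖v‖ ≤ ‖x‖) (a : Fin 4) :
    |pathNum v x a / ‖x‖ ^ 2| ≤ 1 := by
  have := abs_pathNum_le v x hv a
  rw [abs_div, abs_of_pos (by positivity : 0 < ‖x‖ ^ 2), div_le_one (by positivity)]
  nlinarith [abs_nonneg (pathNum v x a)]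

lemma abs_pathCoeffDeriv_le {v x : E3} (hx : 0 < ‖x‖) (hv : 7 * ‖v‖ ≤ ‖x‖) (a : Fin 4) :
    |pathCoeffDeriv v x a| ≤ 1 := by
  have h1 := abs_pathNum_le v x hv a
  have h2 := abs_pathNum_le v x hv 3
  change 7 * |⟪x, v⟫| ≤ _ at h2
  have h3 : |pathNumDeriv v a| ≤ ‖v‖ ^ 2 := by
    fin_cases a <;> simp [pathNumDeriv]
  have h4 : 49 * ‖v‖ ^ 2 ≤ ‖x‖ ^ 2 := by nlinarith [norm_nonneg v]
  rw [pathCoeffDeriv, abs_div, abs_of_pos (by positivity : 0 < (‖x‖ ^ 2) ^ 2),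
    div_le_one (by positivity)]
  refine (abs_sub _ _).trans ?_
  rw [abs_mul, abs_mul, abs_mul, abs_of_pos (by positivity : 0 < ‖x‖ ^ 2), abs_two]
  have h5 := mul_le_mul h1 h2 (by positivity) (by positivity)
  generalize ‖x‖ ^ 2 = N at *
  have hN : 0 ≤ N := by nlinarith [abs_nonneg ⟪x, v⟫]
  nlinarith [mul_le_mul_of_nonneg_right (h3.trans (by linarith : ‖v‖ ^ 2 ≤ N / 49)) hN]

lemma SmoothPos.continuousOn {F : ℝ → E3 → ℝ} (hF : SmoothPos F) :
    ContinuousOn (fun q : ℝ × E3 => F q.1 q.2) posTime := ContDiffOn.continuousOn hF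

/-- Second-order estimate along a segment lifted to a cone. -/
lemma SmoothPos.ray_estimate {F : ℝ → E3 → ℝ} (hF : SmoothPos F) {κ : ℝ} (hκ : 0 < κ)
    {x v : E3} (hx : ∀ s ∈ Icc (0 : ℝ) 1, 0 < ‖x + s • v‖)
    (hv : ∀ s ∈ Icc (0 : ℝ) 1, 7 * ‖v‖ ≤ ‖x + s • v‖) {B : ℝ × E3 → ℝ}
    (hB : ∀ s ∈ Icc (0 : ℝ) 1, ∀ μ : List (Fin 8), μ.length ≤ 2 →
      |Ziter μ F (coneLift κ (x + s • v)).1 (coneLift κ (x + s • v)).2| ≤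
        B (coneLift κ (x + s • v))) :
    ENNReal.ofReal (F (coneLift κ x).1 (coneLift κ x).2 ^ 2) ≤
      4 * ∫⁻ σ in Icc (0 : ℝ) 1, ENNReal.ofReal (σ ^ 6) *
        ENNReal.ofReal ((38 * B (coneLift κ (x + σ ^ 2 • v))) ^ 2) := by
  set γ : ℝ → ℝ × E3 := fun s => coneLift κ (x + s • v) with hγ
  set c : Fin 4 → ℝ → ℝ := fun a s => pathNum v (x + s • v) a / ‖x + s • v‖ ^ 2 with hc
  set c' : Fin 4 → ℝ → ℝ := fun a s => pathCoeffDeriv v (x + s • v) a with hc'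
  have hne : ∀ s ∈ Icc (0 : ℝ) 1, ‖x + s • v‖ ^ 2 ≠ 0 := fun s hs => by
    have := hx s hs; positivity
  have dc : ∀ a, ∀ s ∈ Icc (0 : ℝ) 1, HasDerivAt (c a) (c' a s) s := fun a s hs =>
    (hasDerivAt_pathNum x v a s).fun_div (hasDerivAt_normSq_line x v s) (hne s hs)
  have hcN : ContinuousOn (fun s : ℝ => ‖x + s • v‖ ^ 2) (Icc 0 1) := by fun_prop
  have hcP : ∀ a, ContinuousOn (fun s : ℝ => pathNum v (x + s • v) a) (Icc 0 1) := fun a s _ =>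
    (hasDerivAt_pathNum x v a s).continuousAt.continuousWithinAt
  have cc : ∀ a, ContinuousOn (c a) (Icc 0 1) := fun a => (hcP a).div hcN hne
  have cc' : ∀ a, ContinuousOn (c' a) (Icc 0 1) := fun a => by
    refine ContinuousOn.div ?_ (hcN.pow 2) fun s hs => pow_ne_zero 2 (hne s hs)
    exact (continuousOn_const.mul hcN).sub ((hcP a).mul (by fun_prop))
  have cγ : ContinuousOn γ (Icc 0 1) := by
    simp only [hγ, coneLift]; fun_prop
  have hmem : MapsTo γ (Icc 0 1) posTime := fun s hs => mem_posTime.2 (mul_pos hκ (hx s hs))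
  have cZ : ∀ {G : ℝ → E3 → ℝ}, SmoothPos G →
      ContinuousOn (fun s => G (γ s).1 (γ s).2) (Icc 0 1) := fun hG => hG.continuousOn.comp cγ hmem
  have dZ : ∀ {G : ℝ → E3 → ℝ}, SmoothPos G → ∀ s ∈ Icc (0 : ℝ) 1,
      HasDerivAt (fun s => G (γ s).1 (γ s).2)
        (∑ a, c a s * Zop (homIdx a) G (γ s).1 (γ s).2) s :=
    fun hG s hs => hG.hasDerivAt_coneLift hκ x v s (hx s hs)
  have e0 : F (coneLift κ x).1 (coneLift κ x).2 = F (γ 0).1 (γ 0).2 := by simp [hγ]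
  rw [e0]
  refine sq_zero_le (g := fun s => F (γ s).1 (γ s).2)
    (B := fun s => 38 * B (γ s)) (dZ hF)
    (g₂ := fun s => ∑ a, (c' a s * Zop (homIdx a) F (γ s).1 (γ s).2 +
      c a s * ∑ b, c b s * Zop (homIdx b) (Zop (homIdx a) F) (γ s).1 (γ s).2))
    (fun s hs => HasDerivAt.fun_sum fun a _ => (dc a s hs).fun_mul (dZ (hF.zop _) s hs)) ?_ ?_
  · refine continuousOn_finsetSum _ fun a _ => ((cc' a).mul (cZ (hF.zop _))).add
      ((cc a).mul (continuousOn_finsetSum _ fun b _ => (cc b).mul (cZ ((hF.zop _).zop _))))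
  · intro s hs
    have b0 : |F (γ s).1 (γ s).2| ≤ B (γ s) := hB s hs [] (by simp)
    have b1 : ∀ a, |Zop (homIdx a) F (γ s).1 (γ s).2| ≤ B (γ s) := fun a =>
      hB s hs [homIdx a] (by simp)
    have b2 : ∀ b a, |Zop (homIdx b) (Zop (homIdx a) F) (γ s).1 (γ s).2| ≤ B (γ s) := fun b a =>
      hB s hs [homIdx b, homIdx a] (by simp)
    have hB0 : 0 ≤ B (γ s) := (abs_nonneg _).trans b0
    have k1 : ∀ a, |c a s| ≤ 1 := abs_pathCoeff_le (hx s hs) (hv s hs)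
    have k2 : ∀ a, |c' a s| ≤ 1 := abs_pathCoeffDeriv_le (hx s hs) (hv s hs)
    have m : ∀ {y z M : ℝ}, |y| ≤ 1 → |z| ≤ M → |y * z| ≤ M := fun hy hz => by
      rw [abs_mul]
      exact (mul_le_of_le_one_left (abs_nonneg _) hy).trans hz
    have sum4 : ∀ {f : Fin 4 → ℝ} {M : ℝ}, (∀ a, |f a| ≤ M) → |∑ a, f a| ≤ 4 * M := fun hf =>
      (Finset.abs_sum_le_sum_abs _ _).trans
        ((Finset.sum_le_sum fun a _ => hf a).trans (by simp))
    have t1 := sum4 fun a => m (k1 a) (b1 a)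
    have t2 := sum4 fun a => (abs_add_le _ _).trans (add_le_add (m (k2 a) (b1 a))
      (m (k1 a) (sum4 fun b => m (k1 b) (b2 b a))))
    linarith

lemma isClosed_CUtilde (τ U : ℝ) : IsClosed (CUtilde τ U) := by
  unfold CUtilde
  have h1 : Continuous fun q : ℝ × E3 => ‖q.2‖ := by fun_prop
  have h2 : Continuous fun q : ℝ × E3 => q.1 - ‖q.2‖ := by fun_prop
  refine IsClosed.inter ?_ ?_
  · exact (isClosed_le continuous_const continuous_fst).inter
      ((isClosed_le continuous_fst continuous_const).inter
        (isClosed_le h1 (continuous_fst.add continuous_const)))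
  · split_ifs
    · exact isClosed_le h2.abs continuous_const
    · exact (isClosed_le continuous_const h2).inter (isClosed_le h2 continuous_const)

lemma isCompact_CUtilde (τ U : ℝ) : IsCompact (CUtilde τ U) := by
  refine ((isCompact_Icc (a := 7 / 8 * τ) (b := 17 / 8 * τ)).prod
    (isCompact_closedBall (0 : E3) (17 / 8 * τ + 2))).of_isClosed_subset
    (isClosed_CUtilde τ U) fun q hq => ?_
  obtain ⟨⟨h1, h2, h3⟩, -⟩ := hq
  exact ⟨⟨h1, h2⟩, by simpa using h3.trans (by linarith)⟩

lemma CUtilde_bounds {τ U : ℝ} (hτ : 4 * U ≤ τ) (hU : U = 1 ∨ 2 ≤ U) {q : ℝ × E3}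
    (hq : q ∈ CUtilde τ U) : 0 < q.1 ∧ 0 < ‖q.2‖ ∧ ‖q.2‖ ≤ 4 * τ ∧ q.1 ≤ 16 * ‖q.2‖ ∧
      (U = 1 ∨ U ≤ 2 * |q.1 - ‖q.2‖|) := by
  obtain ⟨⟨h1, h2, h3⟩, h4⟩ := hq
  rcases hU with rfl | hU
  · simp only [if_true] at h4
    have h5 := abs_le.1 (show |q.1 - ‖q.2‖| ≤ 17 / 8 from h4)
    refine ⟨by linarith, by linarith, by linarith, by linarith, Or.inl rfl⟩
  · rw [if_neg (by linarith)] at h4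
    obtain ⟨h5, h6⟩ := h4
    refine ⟨by linarith, by linarith, by linarith, by linarith, Or.inr ?_⟩
    linarith [le_abs_self (q.1 - ‖q.2‖)]

lemma CUtilde_subset_posTime {τ U : ℝ} (hτ : 4 * U ≤ τ) (hU : U = 1 ∨ 2 ≤ U) :
    CUtilde τ U ⊆ posTime := fun _ hq => mem_posTime.2 (CUtilde_bounds hτ hU hq).1

lemma CUreg_bounds {τ U : ℝ} (hτ : 4 * U ≤ τ) (hU : U = 1 ∨ 2 ≤ U) {q : ℝ × E3}
    (hq : q ∈ CUreg τ U) : 0 < q.1 ∧ τ / 2 ≤ ‖q.2‖ := by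
  unfold CUreg at hq
  rcases hU with rfl | hU
  · simp only [if_true] at hq
    obtain ⟨⟨h1, h2, h3⟩, h4⟩ := hq
    have h5 := abs_le.1 (show |q.1 - ‖q.2‖| ≤ 2 from h4)
    exact ⟨by linarith, by linarith⟩
  · rw [if_neg (by linarith)] at hq
    obtain ⟨⟨h1, h2, h3⟩, h5, h6⟩ := hq
    exact ⟨by linarith, by linarith⟩

lemma coneLift_mem_CUtilde {τ U : ℝ} (hτ : 4 * U ≤ τ) (hU : U = 1 ∨ 2 ≤ U) {q : ℝ × E3}
    (hq : q ∈ CUreg τ U) {h : ℝ} (hh : h ∈ Icc q.1 (q.1 + U / 8)) {x : E3}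
    (hx1 : 7 / 8 * ‖q.2‖ ≤ ‖x‖) (hx2 : ‖x‖ ≤ ‖q.2‖) :
    coneLift (h / ‖q.2‖) x ∈ CUtilde τ U := by
  have hr : 0 < ‖q.2‖ := by
    have := (CUreg_bounds hτ hU hq).2
    rcases hU with rfl | hU <;> linarith
  obtain ⟨h1, h2⟩ := hh
  set l := ‖x‖ / ‖q.2‖
  have hl1 : 7 / 8 ≤ l := (le_div_iff₀ hr).2 hx1
  have hl2 : l ≤ 1 := (div_le_one hr).2 hx2
  have hx : ‖x‖ = l * ‖q.2‖ := by simp only [l]; field_simp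
  have ht : h / ‖q.2‖ * ‖x‖ = l * h := by simp only [l]; ring
  unfold CUtilde coneLift
  rw [ht]
  unfold CUreg Cstrip at hq
  have hd : l * h - ‖x‖ = l * (h - ‖q.2‖) := by rw [hx]; ring
  rcases hU with rfl | hU
  · simp only [if_true] at hq ⊢
    obtain ⟨⟨h3, h4, h5⟩, h6⟩ := hq
    have h7 := abs_le.1 (show |q.1 - ‖q.2‖| ≤ 2 from h6)
    refine ⟨⟨?_, ?_, ?_⟩, ?_⟩
    · simp only; nlinarith
    · simp only; nlinarith
    · simp only; nlinarith
    · change |l * h - ‖x‖| ≤ _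
      rw [hd, abs_mul, abs_of_nonneg (by linarith)]
      have : |h - ‖q.2‖| ≤ 17 / 8 := abs_le.2 ⟨by linarith, by linarith⟩
      nlinarith [abs_nonneg (h - ‖q.2‖)]
  · have h0 : U ≠ 1 := by linarith
    rw [if_neg h0] at hq ⊢
    obtain ⟨⟨h3, h4, h5⟩, h6, h7⟩ := hq
    refine ⟨⟨?_, ?_, ?_⟩, ?_, ?_⟩
    · simp only; nlinarith
    · simp only; nlinarith
    · simp only; nlinarith
    · simp only; rw [hd]; nlinarith
    · simp only; rw [hd]; nlinarith

/-- Averaging an estimate along rays issued from `x₀`. -/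
lemma mul_volume_le_of_rays {Φ : E3 → ENNReal} (hΦ : Measurable Φ) {S : Set E3}
    {x₀ : E3} {c : ENNReal}
    (h : ∀ y ∈ S, c ≤ 4 * ∫⁻ σ in Icc (0 : ℝ) 1, ENNReal.ofReal (σ ^ 6) *
      Φ (x₀ + σ ^ 2 • (y - x₀))) (hS : MeasurableSet S) :
    c * volume S ≤ 4 * ∫⁻ x, Φ x := by
  have hm : Measurable (fun p : E3 × ℝ => ENNReal.ofReal (p.2 ^ 6) *
      Φ (x₀ + p.2 ^ 2 • (p.1 - x₀))) := by fun_prop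
  have hin : ∀ σ : ℝ, ENNReal.ofReal (σ ^ 6) * ∫⁻ y, Φ (x₀ + σ ^ 2 • (y - x₀)) ≤
      ∫⁻ x, Φ x := fun σ => by
    rcases eq_or_ne σ 0 with rfl | hσ
    · simp
    have h1 : ∫⁻ y, Φ (x₀ + σ ^ 2 • (y - x₀)) = ∫⁻ y, Φ (x₀ + σ ^ 2 • y) :=
      lintegral_sub_right_eq_self (fun y => Φ (x₀ + σ ^ 2 • y)) x₀
    have h2 : ∫⁻ y, Φ (x₀ + σ ^ 2 • y) = ∫⁻ z, Φ (x₀ + z) ∂(volume.map (fun y => σ ^ 2 • y)) :=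
      (lintegral_map (f := fun z => Φ (x₀ + z)) (by fun_prop) (by fun_prop)).symm
    rw [h1, h2, Measure.map_addHaar_smul _ (by positivity), lintegral_smul_measure,
      lintegral_add_left_eq_self Φ x₀, smul_eq_mul, ← mul_assoc,
      ← ENNReal.ofReal_mul (by positivity)]
    have : σ ^ 6 * |((σ ^ 2) ^ Module.finrank ℝ E3)⁻¹| = 1 := by
      rw [finrank_euclideanSpace_fin, abs_of_nonneg (by positivity)]
      field_simp
    rw [this]; simp
  calc c * volume S = ∫⁻ _ in S, c := by simp
    _ ≤ ∫⁻ y in S, 4 * ∫⁻ σ in Icc (0 : ℝ) 1, ENNReal.ofReal (σ ^ 6) *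
        Φ (x₀ + σ ^ 2 • (y - x₀)) := setLIntegral_mono' hS h
    _ ≤ ∫⁻ y, 4 * ∫⁻ σ in Icc (0 : ℝ) 1, ENNReal.ofReal (σ ^ 6) *
        Φ (x₀ + σ ^ 2 • (y - x₀)) := setLIntegral_le_lintegral _ _
    _ = 4 * ∫⁻ σ in Icc (0 : ℝ) 1, ∫⁻ y, ENNReal.ofReal (σ ^ 6) *
        Φ (x₀ + σ ^ 2 • (y - x₀)) := by
      rw [lintegral_const_mul' _ _ (by simp), lintegral_lintegral_swap hm.aemeasurable]
    _ ≤ 4 * ∫⁻ σ in Icc (0 : ℝ) 1, ∫⁻ x, Φ x := by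
      refine mul_le_mul_right (lintegral_mono fun σ => ?_) _
      rw [lintegral_const_mul' _ _ (by simp)]
      exact hin σ
    _ = 4 * ∫⁻ x, Φ x := by simp

/-- Integrating over a family of cones. -/
lemma lintegral_coneLift_le {G : ℝ × E3 → ENNReal} (hG : Measurable G) {ρ : ℝ} (hρ : 0 < ρ)
    {S : Set E3} (hS : MeasurableSet S) (hx : ∀ x ∈ S, ρ / 2 ≤ ‖x‖) :
    ∫⁻ h : ℝ, ∫⁻ x in S, G (coneLift (h / ρ) x) ≤ 2 * ∫⁻ q, G q := by
  have hm : Measurable (fun p : ℝ × E3 => G (coneLift (p.1 / ρ) p.2)) :=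
    hG.comp (by unfold coneLift; fun_prop)
  rw [lintegral_lintegral_swap hm.aemeasurable, Measure.volume_eq_prod,
    lintegral_prod_symm' _ hG, ← lintegral_const_mul' _ _ (by simp)]
  refine (setLIntegral_mono' hS fun x hxS => ?_).trans (setLIntegral_le_lintegral _ _)
  set l := ‖x‖ / ρ
  have hl : 1 / 2 ≤ l := (le_div_iff₀ hρ).2 (by linarith [hx x hxS])
  have h1 : ∀ h : ℝ, coneLift (h / ρ) x = (l * h, x) := fun h => by
    simp only [coneLift, l]; congr 1; ring
  have h2 : ∫⁻ h : ℝ, G (l * h, x) =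
      ∫⁻ t, G (t, x) ∂(volume.map (fun h : ℝ => l * h)) :=
    (lintegral_map (f := fun t => G (t, x)) (by fun_prop) (by fun_prop)).symm
  simp only [h1]
  rw [h2, Real.map_volume_mul_left (by linarith), lintegral_smul_measure, smul_eq_mul]
  gcongr
  rw [show (2 : ENNReal) = ENNReal.ofReal 2 by simp]
  refine ENNReal.ofReal_le_ofReal ?_
  rw [abs_of_nonneg (by positivity)]
  exact inv_le_of_inv_le₀ (by norm_num) (by linarith)

/-- A ball of size comparable to `‖x‖`, tangent at `x` to the sphere `‖y‖ = ‖x‖` from inside. -/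
def innerBall (x : E3) : Set E3 := Metric.closedBall ((15 / 16 : ℝ) • x) (‖x‖ / 16)

lemma norm_of_mem_innerBall {x y : E3} (hy : y ∈ innerBall x) :
    7 / 8 * ‖x‖ ≤ ‖y‖ ∧ ‖y‖ ≤ ‖x‖ := by
  have h1 : ‖y - (15 / 16 : ℝ) • x‖ ≤ ‖x‖ / 16 := by simpa [innerBall, dist_eq_norm] using hy
  have h2 : ‖(15 / 16 : ℝ) • x‖ = 15 / 16 * ‖x‖ := by rw [norm_smul]; norm_num
  have h3 := abs_le.1 ((abs_norm_sub_norm_le y ((15 / 16 : ℝ) • x)).trans h1)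
  rw [h2] at h3
  constructor <;> linarith

lemma self_mem_innerBall (x : E3) : x ∈ innerBall x := by
  have : x - (15 / 16 : ℝ) • x = (1 / 16 : ℝ) • x := by module
  rw [innerBall, Metric.mem_closedBall, dist_eq_norm, this, norm_smul]
  norm_num
  linarith

lemma segment_innerBall {x y : E3} (hy : y ∈ innerBall x) {s : ℝ} (hs : s ∈ Icc (0 : ℝ) 1) :
    x + s • (y - x) ∈ innerBall x :=
  (convex_closedBall _ _).add_smul_sub_mem (self_mem_innerBall x) hy hs

lemma norm_sub_innerBall {x y : E3} (hy : y ∈ innerBall x) : ‖y - x‖ ≤ ‖x‖ / 8 := by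
  have h := Metric.dist_le_diam_of_mem Metric.isBounded_closedBall hy (self_mem_innerBall x)
  have h2 := Metric.diam_closedBall (x := (15 / 16 : ℝ) • x) (r := ‖x‖ / 16) (by positivity)
  rw [dist_eq_norm] at h
  exact h.trans (h2.trans (by linarith))

lemma SmoothPos.cone_average {F : ℝ → E3 → ℝ} (hF : SmoothPos F) {τ U : ℝ} (hτ : 4 * U ≤ τ)
    (hU : U = 1 ∨ 2 ≤ U) {q : ℝ × E3} (hq : q ∈ CUreg τ U) {B : ℝ × E3 → ℝ}
    (hBc : ContinuousOn B posTime)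
    (hB : ∀ p ∈ CUtilde τ U, ∀ μ : List (Fin 8), μ.length ≤ 2 → |Ziter μ F p.1 p.2| ≤ B p) :
    (∫⁻ h in Icc q.1 (q.1 + U / 8), ENNReal.ofReal (F h q.2 ^ 2)) * volume (innerBall q.2) ≤
      8 * ∫⁻ p in CUtilde τ U, ENNReal.ofReal ((38 * B p) ^ 2) := by
  obtain ⟨hq1, hq2⟩ := CUreg_bounds hτ hU hq
  have hr : 0 < ‖q.2‖ := by rcases hU with rfl | hU <;> linarith
  have hQ : MeasurableSet (CUtilde τ U) := (isClosed_CUtilde τ U).measurableSet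
  have hS : MeasurableSet (innerBall q.2) := Metric.isClosed_closedBall.measurableSet
  have hfin : volume (innerBall q.2) ≠ ⊤ := measure_closedBall_lt_top.ne
  set G : ℝ × E3 → ENNReal :=
    (CUtilde τ U).indicator fun p => ENNReal.ofReal ((38 * B p) ^ 2) with hGdef
  have hG : Measurable G := by
    classical
    rw [hGdef, ← piecewise_eq_indicator]
    refine ContinuousOn.measurable_piecewise ?_ continuousOn_const hQ
    exact ENNReal.continuous_ofReal.comp_continuousOn
      (((hBc.mono (CUtilde_subset_posTime hτ hU)).const_smul (38 : ℝ)).pow 2)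
  have key : ∀ h ∈ Icc q.1 (q.1 + U / 8), ENNReal.ofReal (F h q.2 ^ 2) * volume (innerBall q.2) ≤
      4 * ∫⁻ x in innerBall q.2, G (coneLift (h / ‖q.2‖) x) := fun h hh => by
    have hmem : ∀ x ∈ innerBall q.2, coneLift (h / ‖q.2‖) x ∈ CUtilde τ U := fun x hx =>
      coneLift_mem_CUtilde hτ hU hq hh (norm_of_mem_innerBall hx).1 (norm_of_mem_innerBall hx).2
    rw [← lintegral_indicator hS]
    refine mul_volume_le_of_rays (x₀ := q.2) (Measurable.indicator (hG.comp
      (by unfold coneLift; fun_prop)) hS) (fun y hy => ?_) hS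
    have hx0 : coneLift (h / ‖q.2‖) q.2 = (h, q.2) := by
      simp only [coneLift]; congr 1; field_simp
    have := hF.ray_estimate (x := q.2) (v := y - q.2) (κ := h / ‖q.2‖) (B := B)
      (div_pos (hq1.trans_le hh.1) hr)
      (fun s hs => by
        linarith [(norm_of_mem_innerBall (segment_innerBall hy hs)).1])
      (fun s hs => by
        linarith [(norm_of_mem_innerBall (segment_innerBall hy hs)).1, norm_sub_innerBall hy])
      (fun s hs => hB _ (hmem _ (segment_innerBall hy hs)))
    rw [hx0] at this
    refine this.trans_eq ?_
    congr 1
    refine setLIntegral_congr_fun measurableSet_Icc fun σ hσ => ?_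
    have hm := segment_innerBall hy (s := σ ^ 2)
      ⟨by positivity, pow_le_one₀ hσ.1 hσ.2⟩
    simp only [indicator_of_mem hm, hGdef, Function.comp_apply, indicator_of_mem (hmem _ hm)]
  calc _ = ∫⁻ h in Icc q.1 (q.1 + U / 8), ENNReal.ofReal (F h q.2 ^ 2) * volume (innerBall q.2) :=
        (lintegral_mul_const' _ _ hfin).symm
    _ ≤ ∫⁻ h in Icc q.1 (q.1 + U / 8), 4 * ∫⁻ x in innerBall q.2, G (coneLift (h / ‖q.2‖) x) :=
        setLIntegral_mono' measurableSet_Icc key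
    _ ≤ ∫⁻ h, 4 * ∫⁻ x in innerBall q.2, G (coneLift (h / ‖q.2‖) x) :=
        setLIntegral_le_lintegral _ _
    _ ≤ 4 * (2 * ∫⁻ p, G p) := by
        rw [lintegral_const_mul' _ _ (by simp)]
        refine mul_le_mul_right (lintegral_coneLift_le hG hr hS fun x hx => ?_) _
        linarith [(norm_of_mem_innerBall hx).1]
    _ = _ := by
        rw [hGdef, lintegral_indicator hQ, ← mul_assoc]; norm_num

lemma SmoothPos.sq_le_lintegral {F : ℝ → E3 → ℝ} (hF : SmoothPos F) {q : ℝ × E3} (hq : 0 < q.1)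
    {L : ℝ} (hL : 0 < L) :
    ENNReal.ofReal (F q.1 q.2 ^ 2) ≤
      ENNReal.ofReal (2 / L) * (∫⁻ h in Icc q.1 (q.1 + L), ENNReal.ofReal (F h q.2 ^ 2)) +
      ENNReal.ofReal (2 * L) *
        ∫⁻ h in Icc q.1 (q.1 + L), ENNReal.ofReal (Zop 0 F h q.2 ^ 2) := by
  have hpos : ∀ t ∈ Icc q.1 (q.1 + L), 0 < t := fun t ht => hq.trans_le ht.1
  have hd : ∀ t ∈ Icc q.1 (q.1 + L), HasDerivAt (fun t => F t q.2) (Zop 0 F t q.2) t :=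
    fun t ht => by
    have h1 : DifferentiableAt ℝ (fun p : ℝ × E3 => F p.1 p.2) (t, q.2) :=
      hF.differentiableAt (q := (t, q.2)) (hpos t ht)
    exact (h1.comp t (by fun_prop : DifferentiableAt ℝ (fun t : ℝ => (t, q.2)) t)).hasDerivAt
  have hc : ContinuousOn (fun t => Zop 0 F t q.2) (Icc q.1 (q.1 + L)) :=
    (hF.zop 0).continuousOn.comp (by fun_prop : ContinuousOn (fun t : ℝ => (t, q.2)) _)
      fun t ht => mem_posTime.2 (hpos t ht)
  have hcF : ContinuousOn (fun t => F t q.2) (Icc q.1 (q.1 + L)) := fun t ht =>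
    (hd t ht).continuousAt.continuousWithinAt
  have h := sq_left_le (by linarith) hd hc
  rw [add_sub_cancel_left] at h
  refine h.trans_eq ?_
  have hm : ∀ {f : ℝ → ℝ}, ContinuousOn f (Icc q.1 (q.1 + L)) → AEMeasurable
      (fun t => ENNReal.ofReal (f t ^ 2)) (volume.restrict (Icc q.1 (q.1 + L))) := fun hf =>
    ((hf.pow 2).aemeasurable measurableSet_Icc).ennreal_ofReal
  rw [← lintegral_const_mul'' _ (hm hcF), ← lintegral_const_mul'' _ (hm hc),
    ← lintegral_add_left' ((hm hcF).const_mul _)]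
  refine lintegral_congr fun t => ?_
  rw [ENNReal.ofReal_add (by positivity) (by positivity), ENNReal.ofReal_mul (by positivity),
    ENNReal.ofReal_mul (by positivity)]

lemma lintegral_ofReal_sq_eq {α : Type*} [MeasurableSpace α] (g : α → ℝ) (μ : Measure α) :
    ∫⁻ a, ENNReal.ofReal (g a ^ 2) ∂μ = eLpNorm g 2 μ ^ 2 := by
  have h := eLpNorm_nnreal_pow_eq_lintegral (μ := μ) (f := g) (p := 2) (by norm_num)
  norm_num at h
  rw [h]
  refine lintegral_congr fun a => ?_
  rw [← sq_abs, ENNReal.ofReal_pow (abs_nonneg _), Real.enorm_eq_ofReal_abs]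

lemma eLpNorm_eq_L2st {f : ℝ → E3 → ℝ} {Q : Set (ℝ × E3)} (hQ : IsCompact Q)
    (hf : ContinuousOn (fun q : ℝ × E3 => f q.1 q.2) Q) :
    eLpNorm (fun q : ℝ × E3 => f q.1 q.2) 2 (volume.restrict Q) = ENNReal.ofReal (L2st f Q) := by
  have h := lintegral_ofReal_sq_eq (fun q : ℝ × E3 => f q.1 q.2) (volume.restrict Q)
  rw [← ofReal_integral_eq_lintegral_ofReal (f := fun q : ℝ × E3 => f q.1 q.2 ^ 2)
      ((hf.pow 2).integrableOn_compact hQ)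
    (ae_of_all _ fun q => sq_nonneg _)] at h
  have h2 : ENNReal.ofReal (L2st f Q) ^ 2 =
      ENNReal.ofReal (∫ q in Q, (f q.1 q.2) ^ 2) := by
    rw [L2st, ← ENNReal.ofReal_pow (Real.sqrt_nonneg _),
      Real.sq_sqrt (integral_nonneg fun q => sq_nonneg _)]
  rw [← h2] at h
  exact ((ENNReal.pow_right_strictMono two_ne_zero).injective h).symm

lemma ZnormT_nonneg (T : (ℝ → E3 → ℝ) → (ℝ → E3 → ℝ)) (N : ℕ) (w : ℝ → E3 → ℝ)
    (Q : Set (ℝ × E3)) : 0 ≤ ZnormT T N w Q :=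
  Finset.sum_nonneg fun _ _ => Finset.sum_nonneg fun _ _ => Real.sqrt_nonneg _

lemma eLpNorm_wordSum_le {T : (ℝ → E3 → ℝ) → (ℝ → E3 → ℝ)} {N : ℕ} {w : ℝ → E3 → ℝ}
    {Q : Set (ℝ × E3)} (hQ : IsCompact Q)
    (hT : ∀ l, ContinuousOn (fun q : ℝ × E3 => T (Ziter l w) q.1 q.2) Q) :
    eLpNorm (wordSum T N w) 2 (volume.restrict Q) ≤ ENNReal.ofReal (ZnormT T N w Q) := by
  have hm : ∀ l, AEStronglyMeasurable (fun q : ℝ × E3 => |T (Ziter l w) q.1 q.2|)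
      (volume.restrict Q) := fun l => (hT l).abs.aestronglyMeasurable hQ.measurableSet
  have e : wordSum T N w = ∑ n ∈ Finset.range (N + 1), ∑ σ : Fin n → Fin 8,
      fun q : ℝ × E3 => |T (Ziter (List.ofFn σ) w) q.1 q.2| := by
    ext q; simp [wordSum]
  have hL : ∀ l, 0 ≤ L2st (T (Ziter l w)) Q := fun l => Real.sqrt_nonneg _
  rw [e, ZnormT, ENNReal.ofReal_sum_of_nonneg fun n _ => Finset.sum_nonneg fun σ _ => hL _]
  refine (eLpNorm_sum_le (fun n _ => Finset.aestronglyMeasurable_sum _ fun σ _ => hm _)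
    (by norm_num)).trans (Finset.sum_le_sum fun n _ => ?_)
  rw [ENNReal.ofReal_sum_of_nonneg fun σ _ => hL _]
  refine (eLpNorm_sum_le (fun σ _ => hm _) (by norm_num)).trans (Finset.sum_le_sum fun σ _ => ?_)
  rw [← eLpNorm_eq_L2st hQ (hT _)]
  exact (eLpNorm_norm (fun q : ℝ × E3 => T (Ziter (List.ofFn σ) w) q.1 q.2)).le

lemma continuousOn_wordSum {T : (ℝ → E3 → ℝ) → (ℝ → E3 → ℝ)} {N : ℕ} {w : ℝ → E3 → ℝ}
    {Q : Set (ℝ × E3)}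
    (hT : ∀ l, ContinuousOn (fun q : ℝ × E3 => T (Ziter l w) q.1 q.2) Q) :
    ContinuousOn (wordSum T N w) Q :=
  continuousOn_finsetSum _ fun _ _ => continuousOn_finsetSum _ fun _ _ => (hT _).abs

lemma SmoothPos.continuousOn_sqrt_DuSq {u : ℝ → E3 → ℝ} (hu : SmoothPos u) :
    ContinuousOn (fun q : ℝ × E3 => Real.sqrt (DuSq u q.1 q.2)) posTime := by
  simp only [DuSq_eq_sum]
  exact (continuousOn_finsetSum _ fun k _ => ((hu.zop _).continuousOn.pow 2)).sqrt

lemma SmoothPos.continuousOn_box {u : ℝ → E3 → ℝ} (hu : SmoothPos u) :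
    ContinuousOn (fun q : ℝ × E3 => box u q.1 q.2) posTime := by
  have h := fun i => ((hu.zop i).zop i).continuousOn
  exact (h 0).sub (continuousOn_finsetSum _ fun i _ => by
    fin_cases i
    exacts [h 1, h 2, h 3])

/-- The estimate for one component of the gradient, before taking square roots. -/
lemma SmoothPos.coord_sq_bound {w : ℝ → E3 → ℝ} (hw : SmoothPos w) {τ U : ℝ} (hτ : 4 * U ≤ τ)
    (hU : U = 1 ∨ 2 ≤ U) {q : ℝ × E3} (hq : q ∈ CUreg τ U) (k : Fin 4) :
    (Zop (coordIdx k) w q.1 q.2) ^ 2 * ((‖q.2‖ / 16) ^ 3 * volume.real (Metric.ball (0 : E3) 1)) ≤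
      130 * (38 * wordConst) ^ 2 / U *
        (ZnormD 3 w (CUtilde τ U) + τ * ZnormBox 2 w (CUtilde τ U)) ^ 2 := by
  obtain ⟨hq1, hq2⟩ := CUreg_bounds hτ hU hq
  have hU0 : 0 < U := by rcases hU with rfl | hU <;> linarith
  have hτ0 : 0 < τ := by linarith
  have hK : 0 ≤ wordConst := by unfold wordConst; have := commBound_nonneg; positivity
  have hQ := isCompact_CUtilde τ U
  have hQp := CUtilde_subset_posTime hτ hU
  set A := ZnormD 3 w (CUtilde τ U)
  set D := ZnormBox 2 w (CUtilde τ U)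
  have hA : 0 ≤ A := ZnormT_nonneg _ _ _ _
  have hD : 0 ≤ D := ZnormT_nonneg _ _ _ _
  have hPc : ContinuousOn (gradWords w) posTime :=
    continuousOn_wordSum fun l => (hw.ziter l).continuousOn_sqrt_DuSq
  have hbc : ContinuousOn (boxWords w) posTime :=
    continuousOn_wordSum fun l => (hw.ziter l).continuousOn_box
  have hPn : eLpNorm (gradWords w) 2 (volume.restrict (CUtilde τ U)) ≤ ENNReal.ofReal A :=
    eLpNorm_wordSum_le hQ fun l => (hw.ziter l).continuousOn_sqrt_DuSq.mono hQp
  have hbn : eLpNorm (boxWords w) 2 (volume.restrict (CUtilde τ U)) ≤ ENNReal.ofReal D :=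
    eLpNorm_wordSum_le hQ fun l => (hw.ziter l).continuousOn_box.mono hQp
  have hsmul : ∀ {c a : ℝ} {g : ℝ × E3 → ℝ}, 0 ≤ c →
      eLpNorm g 2 (volume.restrict (CUtilde τ U)) ≤ ENNReal.ofReal a →
      eLpNorm (fun p => c * g p) 2 (volume.restrict (CUtilde τ U)) ≤ ENNReal.ofReal (c * a) :=
    fun {c a g} hc h => by
      rw [ENNReal.ofReal_mul hc, ← Real.enorm_eq_ofReal hc]
      exact (eLpNorm_const_smul_le (c := c) (f := g)).trans (by gcongr)
  have hsum : eLpNorm (fun p => gradWords w p + τ * boxWords w p) 2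
      (volume.restrict (CUtilde τ U)) ≤ ENNReal.ofReal (A + τ * D) := by
    rw [ENNReal.ofReal_add hA (by positivity)]
    exact (eLpNorm_add_le ((hPc.mono hQp).aestronglyMeasurable hQ.measurableSet)
      ((continuousOn_const.mul (hbc.mono hQp)).aestronglyMeasurable hQ.measurableSet)
      (by norm_num)).trans (add_le_add hPn (hsmul hτ0.le hbn))
  have hlint : ∀ {a : ℝ} {g : ℝ × E3 → ℝ}, 0 ≤ a →
      eLpNorm g 2 (volume.restrict (CUtilde τ U)) ≤ ENNReal.ofReal a →
      ∫⁻ p in CUtilde τ U, ENNReal.ofReal ((38 * g p) ^ 2) ≤ ENNReal.ofReal ((38 * a) ^ 2) :=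
    fun {a g} ha h => by
      rw [lintegral_ofReal_sq_eq, ENNReal.ofReal_pow (by positivity)]
      gcongr
      exact hsmul (by norm_num) h
  set F := Zop (coordIdx k) w
  have hF : SmoothPos F := hw.zop _
  have h0 := hF.cone_average hτ hU hq (B := fun p => wordConst * gradWords w p)
    (continuousOn_const.mul hPc) fun p hp μ hμ =>
      hw.coord_words_bound (CUtilde_bounds hτ hU hp).1 hμ k
  have h1 := (hF.zop 0).cone_average hτ hU hq
    (B := fun p => wordConst / U * (gradWords w p + τ * boxWords w p))
    (continuousOn_const.mul (hPc.add (continuousOn_const.mul hbc))) fun p hp μ hμ => by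
      obtain ⟨b1, b2, b3, b4, b5⟩ := CUtilde_bounds hτ hU hp
      have := hw.hessian_words_bound b1 b2 b3 b4 hU0 b5 hμ 0 k
      rw [div_mul_eq_mul_div, le_div_iff₀ hU0, mul_comm]
      exact this
  replace h0 := h0.trans (mul_le_mul_right (hlint (by positivity) (hsmul hK hPn)) _)
  replace h1 := h1.trans (mul_le_mul_right (hlint (by positivity)
    (hsmul (div_nonneg hK hU0.le) hsum)) _)
  have h2 := hF.sq_le_lintegral hq1 (show 0 < U / 8 by positivity)
  set V := volume (innerBall q.2)
  have hV : V = ENNReal.ofReal ((‖q.2‖ / 16) ^ 3 * volume.real (Metric.ball (0 : E3) 1)) := by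
    rw [ENNReal.ofReal_mul (by positivity), Measure.real,
      ENNReal.ofReal_toReal measure_ball_lt_top.ne]
    have := Measure.addHaar_closedBall (volume : Measure E3) ((15 / 16 : ℝ) • q.2)
      (show 0 ≤ ‖q.2‖ / 16 by positivity)
    rwa [finrank_euclideanSpace_fin] at this
  have h3 : ENNReal.ofReal (F q.1 q.2 ^ 2) * V ≤ ENNReal.ofReal (2 / (U / 8)) *
      (8 * ENNReal.ofReal ((38 * (wordConst * A)) ^ 2)) + ENNReal.ofReal (2 * (U / 8)) *
      (8 * ENNReal.ofReal ((38 * (wordConst / U * (A + τ * D))) ^ 2)) := by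
    refine (mul_le_mul_left h2 V).trans ?_
    rw [add_mul, mul_assoc, mul_assoc]
    exact add_le_add (mul_le_mul_right h0 _) (mul_le_mul_right h1 _)
  rw [hV, ← ENNReal.ofReal_mul (sq_nonneg _), show (8 : ENNReal) = ENNReal.ofReal 8 by simp,
    ← ENNReal.ofReal_mul (p := 8) (by norm_num), ← ENNReal.ofReal_mul (p := 8) (by norm_num),
    ← ENNReal.ofReal_mul (by positivity), ← ENNReal.ofReal_mul (by positivity),
    ← ENNReal.ofReal_add (by positivity) (by positivity),
    ENNReal.ofReal_le_ofReal_iff (by positivity)] at h3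
  have h4 : A ^ 2 ≤ (A + τ * D) ^ 2 := by
    gcongr
    linarith [mul_nonneg hτ0.le hD]
  calc _ ≤ _ := h3
    _ = 128 * (38 * wordConst) ^ 2 / U * A ^ 2 +
        2 * (38 * wordConst) ^ 2 / U * (A + τ * D) ^ 2 := by field_simp; ring
    _ ≤ 128 * (38 * wordConst) ^ 2 / U * (A + τ * D) ^ 2 +
        2 * (38 * wordConst) ^ 2 / U * (A + τ * D) ^ 2 := by gcongr
    _ = _ := by ring

lemma SmoothPos.sqrt_DuSq_le {w : ℝ → E3 → ℝ} (hw : SmoothPos w) {τ U : ℝ} (hτ : 4 * U ≤ τ)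
    (hU : U = 1 ∨ 2 ≤ U) {q : ℝ × E3} (hq : q ∈ CUreg τ U) :
    Real.sqrt (DuSq w q.1 q.2) ≤
      Real.sqrt (520 * 32 ^ 3 * (38 * wordConst) ^ 2 / volume.real (Metric.ball (0 : E3) 1)) *
        (U ^ (-(1/2 : ℝ)) * τ ^ (-(3/2 : ℝ)) * ZnormD 3 w (CUtilde τ U) +
          U ^ (-(1/2 : ℝ)) * τ ^ (-(1/2 : ℝ)) * ZnormBox 2 w (CUtilde τ U)) := by
  have hU0 : 0 < U := by rcases hU with rfl | hU <;> linarith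
  have hτ0 : 0 < τ := by linarith
  obtain ⟨-, hq2⟩ := CUreg_bounds hτ hU hq
  set A := ZnormD 3 w (CUtilde τ U)
  set D := ZnormBox 2 w (CUtilde τ U)
  have hA : 0 ≤ A := ZnormT_nonneg _ _ _ _
  have hD : 0 ≤ D := ZnormT_nonneg _ _ _ _
  have hv : 0 < volume.real (Metric.ball (0 : E3) 1) :=
    ENNReal.toReal_pos (Metric.measure_ball_pos _ _ one_pos).ne' measure_ball_lt_top.ne
  have hk := fun k => hw.coord_sq_bound hτ hU hq k
  set v := volume.real (Metric.ball (0 : E3) 1)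
  set M := (38 * wordConst) ^ 2
  have hM : 0 ≤ M := sq_nonneg _
  have hr : (τ / 32) ^ 3 ≤ (‖q.2‖ / 16) ^ 3 := by gcongr ?_ ^ 3; linarith
  have hk' : ∀ k, (Zop (coordIdx k) w q.1 q.2) ^ 2 ≤
      130 * 32 ^ 3 * M / v * (U⁻¹ * (τ ^ 3)⁻¹ * (A + τ * D) ^ 2) := fun k => by
    have h1 : (Zop (coordIdx k) w q.1 q.2) ^ 2 * ((τ / 32) ^ 3 * v) ≤
        130 * M / U * (A + τ * D) ^ 2 := le_trans (by gcongr) (hk k)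
    rw [← le_div_iff₀ (by positivity)] at h1
    refine h1.trans_eq ?_
    field_simp
  have e1 : (U ^ (-(1/2 : ℝ))) ^ 2 = U⁻¹ := by
    rw [← Real.rpow_mul_natCast hU0.le, ← Real.rpow_neg_one]; norm_num
  have e2 : (τ ^ (-(3/2 : ℝ))) ^ 2 = (τ ^ 3)⁻¹ := by
    rw [← Real.rpow_mul_natCast hτ0.le, ← Real.rpow_natCast, ← Real.rpow_neg hτ0.le]; norm_num
  have e3 : τ ^ (-(1/2 : ℝ)) = τ * τ ^ (-(3/2 : ℝ)) := by
    rw [← Real.rpow_one_add' hτ0.le (by norm_num)]; norm_num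
  refine Real.sqrt_le_iff.2 ⟨by positivity, ?_⟩
  rw [DuSq_eq_sum]
  refine (Finset.sum_le_sum fun k _ => hk' k).trans_eq ?_
  rw [mul_pow, Real.sq_sqrt (by positivity), e3, ← e1, ← e2]
  simp only [Finset.sum_const, Finset.card_univ, Fintype.card_fin, nsmul_eq_mul]
  push_cast
  ring

/-- Klainerman–Sobolev estimate for the gradient on the regions `C^U_τ`:
for dyadic `τ = 2^j ≥ 1` and dyadic `1 ≤ U = 2^m ≤ τ/4`,
`‖∂w‖_{L^∞(C^U_τ)} ≲ U^{−1/2}τ^{−3/2}‖∂Z^{≤3}w‖_{L²L²(C̃^U_τ)}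
  + U^{−1/2}τ^{−1/2}‖□Z^{≤2}w‖_{L²L²(C̃^U_τ)}`. -/
theorem spacetime_KS_grad_U :
    ∃ C : ℝ, 0 < C ∧ ∀ w : ℝ → E3 → ℝ,
      ContDiffOn ℝ (⊤ : ℕ∞) (fun q : ℝ × E3 => w q.1 q.2) (Ici 0 ×ˢ univ) →
      ∀ j m : ℕ, m + 2 ≤ j →
      ∀ q ∈ CUreg ((2:ℝ)^j) ((2:ℝ)^m), Real.sqrt (DuSq w q.1 q.2) ≤
        C * (((2:ℝ)^m) ^ (-(1/2 : ℝ)) * ((2:ℝ)^j) ^ (-(3/2 : ℝ)) *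
               ZnormD 3 w (CUtilde ((2:ℝ)^j) ((2:ℝ)^m)) +
             ((2:ℝ)^m) ^ (-(1/2 : ℝ)) * ((2:ℝ)^j) ^ (-(1/2 : ℝ)) *
               ZnormBox 2 w (CUtilde ((2:ℝ)^j) ((2:ℝ)^m))) := by
  have hv : 0 < volume.real (Metric.ball (0 : E3) 1) :=
    ENNReal.toReal_pos (Metric.measure_ball_pos _ _ one_pos).ne' measure_ball_lt_top.ne
  have hK : 0 < wordConst := by unfold wordConst; have := commBound_nonneg; positivity
  refine ⟨_, Real.sqrt_pos.2 (by positivity), fun w hw j m hjm q hq =>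
    SmoothPos.sqrt_DuSq_le (hw.mono (prod_mono_left Ioi_subset_Ici_self)) ?_ ?_ hq⟩
  · calc (4 : ℝ) * 2 ^ m = 2 ^ (m + 2) := by ring
      _ ≤ 2 ^ j := pow_le_pow_right₀ one_le_two hjm
  · rcases Nat.eq_zero_or_pos m with rfl | hm
    · simp
    · right
      simpa using pow_le_pow_right₀ (one_le_two (α := ℝ)) hm
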